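/- Let K be a compact subset of (0,2) and let k, l, m ∈ ℕ. There exists C > 0 such that for all α ∈ K, all w ∈ (0, 1/3] and all y ∈ ℝ: (i) |f_α^{(k,0,0)}(y,w)| ≤ C ln(1/w)^k (φ(y) + w^α ψ_α^{(0)}(y)); and (ii) if l + m > 0, then |f_α^{(k,l,m)}(y,w)| ≤ C ln(1/w)^m w^α ψ_α^{(m)}(y). -/

import Mathlib

open MeasureTheory Filter Set Topology Matrix

noncomputable section

namespace LevyLAN

/-- Standard Gaussian density `φ`. -/
def gauss (y : ℝ) : ℝ := (Real.sqrt (2 * Real.pi))⁻¹ * Real.exp (-(y ^ 2) / 2)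

/-- Symmetric `α`-stable density `φ_α`, defined by Fourier inversion. -/
def stableDensity (α z : ℝ) : ℝ :=
  (2 * Real.pi)⁻¹ * ∫ u : ℝ, Real.cos (z * u) * Real.exp (-(|u| ^ α))

/-- `∂_α φ_α`. -/
def stableDensityDalpha (α z : ℝ) : ℝ :=
  -(2 * Real.pi)⁻¹ * ∫ u : ℝ, Real.cos (z * u) * |u| ^ α * Real.log |u| * Real.exp (-(|u| ^ α))

/-- The operator `(D f) y = (y * f y)' = f y + y * f' y`. -/
def Dop (f : ℝ → ℝ) (y : ℝ) : ℝ := f y + y * deriv f y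

/-- `f_α(y, w)`. -/
def fFun (α y w : ℝ) : ℝ := ∫ z : ℝ, gauss (y - w * z) * stableDensity α z

/-- `g_α(y, w)`. -/
def gFun (α y w : ℝ) : ℝ := ∫ z : ℝ, Dop gauss (y - w * z) * stableDensity α z

/-- `h_α(y, w)`. -/
def hFun (α y w : ℝ) : ℝ := ∫ z : ℝ, gauss (y - w * z) * Dop (stableDensity α) z

/-- `k_α(y, w)`. -/
def kFun (α y w : ℝ) : ℝ := ∫ z : ℝ, gauss (y - w * z) * stableDensityDalpha α z

/-- `c_α`. -/
def cAlpha (α : ℝ) : ℝ :=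
  if α = 1 then 1 / Real.pi
  else -(α * (α - 1)) / (2 * Real.Gamma (2 - α) * Real.cos (Real.pi * α / 2))

/-- `w_n(θ) = n^{1/2 - 1/α} δ / σ`. -/
def wn (n : ℕ) (σ δ α : ℝ) : ℝ := (n : ℝ) ^ ((1 : ℝ) / 2 - 1 / α) * δ / σ

/-- `l_α(y, w)` (it depends on `n`). -/
def lFun (n : ℕ) (α y w : ℝ) : ℝ :=
  ((Real.log n - Real.log (Real.log n)) / (2 * α) - Real.log n / α ^ 2) * hFun α y w
    + kFun α y w

def kappa0 (σ δ α : ℝ) : ℝ := 2 * cAlpha α / (α * (2 - α) ^ (α / 2)) * (δ / σ) ^ α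

def kappa1 (σ δ α : ℝ) : ℝ :=
  Real.log (δ / σ) + deriv cAlpha α / cAlpha α - Real.log (2 - α) / 2 - 1 / α

/-- The density `p_{1/n}(y, θ)`, with parameter `θ = (σ, δ, α) : Fin 3 → ℝ`. -/
def pdens (n : ℕ) (θ : Fin 3 → ℝ) (y : ℝ) : ℝ :=
  Real.sqrt n / θ 0 * fFun (θ 2) (Real.sqrt n * y / θ 0) (wn n (θ 0) (θ 1) (θ 2))

/-- The log-likelihood `ln L_n(θ)`. -/
def logLik (n : ℕ) (θ : Fin 3 → ℝ) (x : Fin n → ℝ) : ℝ :=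
  ∑ i, Real.log (pdens n θ (x i))

/-- Partial derivative in the `j`-th parameter coordinate. -/
def pderiv (j : Fin 3) (F : (Fin 3 → ℝ) → ℝ) (θ : Fin 3 → ℝ) : ℝ :=
  deriv (fun t => F (Function.update θ j t)) (θ j)

/-- The score `G_n(θ) = ∇_θ ln L_n(θ)`. -/
def scoreVec (n : ℕ) (θ : Fin 3 → ℝ) (x : Fin n → ℝ) : Fin 3 → ℝ :=
  fun j => pderiv j (fun θ' => logLik n θ' x) θ

/-- The Hessian matrix `J_n(θ)` of the log-likelihood. -/
def hessMat (n : ℕ) (θ : Fin 3 → ℝ) (x : Fin n → ℝ) : Matrix (Fin 3) (Fin 3) ℝ :=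
  Matrix.of fun i j => pderiv i (fun θ' => pderiv j (fun θ'' => logLik n θ'' x) θ') θ

def rate (n : ℕ) (α : ℝ) : ℝ := Real.log n ^ (α / 4) / (n : ℝ) ^ (α / 4)

/-- The rate matrix `u_n(θ)`. -/
def un (n : ℕ) (θ : Fin 3 → ℝ) : Matrix (Fin 3) (Fin 3) ℝ :=
  !![1 / Real.sqrt n, 0, 0;
     0, rate n (θ 2), -(rate n (θ 2) * (θ 1 / (2 * θ 2)) * (Real.log n - Real.log (Real.log n)));
     0, 0, rate n (θ 2)]

/-- The information matrix `I(θ)`. -/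
def Imat (θ : Fin 3 → ℝ) : Matrix (Fin 3) (Fin 3) ℝ :=
  !![2 / θ 0 ^ 2, 0, 0;
     0, θ 2 ^ 2 / θ 1 ^ 2 * kappa0 (θ 0) (θ 1) (θ 2),
        θ 2 / θ 1 * kappa0 (θ 0) (θ 1) (θ 2) * kappa1 (θ 0) (θ 1) (θ 2);
     0, θ 2 / θ 1 * kappa0 (θ 0) (θ 1) (θ 2) * kappa1 (θ 0) (θ 1) (θ 2),
        kappa0 (θ 0) (θ 1) (θ 2) * (kappa1 (θ 0) (θ 1) (θ 2) ^ 2 + 1 / θ 2 ^ 2)]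

/-- `ℙ_n`, the `n`-fold product of the law with Lebesgue density `p_{1/n}(·, θ)`. -/
def Pn (n : ℕ) (θ : Fin 3 → ℝ) : Measure (Fin n → ℝ) :=
  Measure.pi fun _ => MeasureTheory.volume.withDensity fun y => ENNReal.ofReal (pdens n θ y)

/-- The standard Gaussian measure on `ℝ³`. -/
def stdGauss3 : Measure (Fin 3 → ℝ) :=
  Measure.pi fun _ => ProbabilityTheory.gaussianReal 0 1

/-- Euclidean (Frobenius) norm of a real 3×3 matrix. -/
def frobNorm (M : Matrix (Fin 3) (Fin 3) ℝ) : ℝ := Real.sqrt (∑ i, ∑ j, M i j ^ 2)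

/-- Euclidean norm of a vector of `ℝ³`. -/
def vecNorm (v : Fin 3 → ℝ) : ℝ := Real.sqrt (∑ j, v j ^ 2)

/-- The admissible families of functions `ψ_α^{(p)}`. -/
structure IsPsiFamily (ψ : ℝ → ℕ → ℝ → ℝ) : Prop where
  contDiff : ∀ α ∈ Set.Ioo (0 : ℝ) 2, ∀ p : ℕ, ContDiff ℝ 2 (ψ α p)
  pos : ∀ α ∈ Set.Ioo (0 : ℝ) 2, ∀ p : ℕ, ∀ y : ℝ, 0 < ψ α p y
  even : ∀ α ∈ Set.Ioo (0 : ℝ) 2, ∀ p : ℕ, ∀ y : ℝ, ψ α p (-y) = ψ α p y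
  eq_one : ∀ α ∈ Set.Ioo (0 : ℝ) 2, ∀ p : ℕ, ∀ y : ℝ, |y| ≤ 1 → ψ α p y = 1
  eq_tail : ∀ α ∈ Set.Ioo (0 : ℝ) 2, ∀ p : ℕ, ∀ y : ℝ, 3 ≤ |y| →
    ψ α p y = Real.log |y| ^ p / |y| ^ (α + 1)
  unifBound : ∀ K : Set ℝ, K ⊆ Set.Ioo (0 : ℝ) 2 → IsCompact K → ∀ p : ℕ,
    ∃ c > (0 : ℝ), ∃ C : ℝ, ∀ α ∈ K, ∀ y : ℝ, 1 ≤ |y| → |y| ≤ 3 →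
      c ≤ ψ α p y ∧ ψ α p y ≤ C

/-- `𝓘_α^{(k,l)}`. -/
def Ical (ψ : ℝ → ℕ → ℝ → ℝ) (α : ℝ) (k l : ℕ) (y : ℝ) : ℝ :=
  ∫ z in {z : ℝ | 1 < |z|}, Dop^[k] gauss (y - z) * ψ α l z

/-- `f_α^{(k,l,m)}`. -/
def fklm (α : ℝ) (k l m : ℕ) (y w : ℝ) : ℝ :=
  ∫ z : ℝ, Dop^[k] gauss (y - w * z)
    * Dop^[l] (fun z' => iteratedDeriv m (fun a => stableDensity a z') α) z

def Gamman (n : ℕ) (α : ℝ) : ℝ := Real.sqrt ((1 - α / 2) * Real.log n)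

def Mn (n : ℕ) (α : ℝ) : ℝ := Real.sqrt ((2 - α) * Real.log n)

def Kconst (σ δ α : ℝ) : ℝ := deriv cAlpha α + cAlpha α * Real.log (δ / σ)


/-! ### Part 1: elementary bounds -/

lemma poly_bound (P : Polynomial ℝ) :
    ∃ C > (0:ℝ), ∀ x : ℝ, |P.eval x| ≤ C * (1 + |x|) ^ P.natDegree := by
  refine ⟨1 + ∑ i ∈ Finset.range (P.natDegree + 1), |P.coeff i|, ?_, fun x => ?_⟩
  · have : 0 ≤ ∑ i ∈ Finset.range (P.natDegree + 1), |P.coeff i| :=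
      Finset.sum_nonneg fun _ _ => abs_nonneg _
    linarith
  · rw [Polynomial.eval_eq_sum_range]
    have h1 : (1:ℝ) ≤ 1 + |x| := by linarith [abs_nonneg x]
    have h0 : 0 ≤ (1 + |x|) ^ P.natDegree := by positivity
    calc |∑ i ∈ Finset.range (P.natDegree + 1), P.coeff i * x ^ i|
        ≤ ∑ i ∈ Finset.range (P.natDegree + 1), |P.coeff i * x ^ i| :=
          Finset.abs_sum_le_sum_abs _ _
      _ ≤ ∑ i ∈ Finset.range (P.natDegree + 1), |P.coeff i| * (1 + |x|) ^ P.natDegree := by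
          refine Finset.sum_le_sum fun i hi => ?_
          rw [abs_mul, abs_pow]
          refine mul_le_mul_of_nonneg_left ?_ (abs_nonneg _)
          calc |x| ^ i ≤ (1 + |x|) ^ i := by gcongr; linarith
            _ ≤ (1 + |x|) ^ P.natDegree :=
              pow_le_pow_right₀ h1 (by simp at hi; omega)
      _ = (∑ i ∈ Finset.range (P.natDegree + 1), |P.coeff i|) * (1 + |x|) ^ P.natDegree := by
          rw [Finset.sum_mul]
      _ ≤ _ := by nlinarith

lemma pow_le_fact_exp (n : ℕ) {x : ℝ} (hx : 0 ≤ x) : x ^ n ≤ n.factorial * Real.exp x := by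
  have := Real.pow_div_factorial_le_exp x hx n
  rw [div_le_iff₀ (by positivity)] at this
  linarith

lemma log_pow_le (ε : ℝ) (hε : 0 < ε) (i : ℕ) :
    ∃ C > (0:ℝ), ∀ v : ℝ, 1 ≤ v → (1 + Real.log v) ^ i ≤ C * v ^ ε := by
  set δ := ε / (i + 1) with hδ
  have hδ0 : 0 < δ := by positivity
  refine ⟨(1 + 1 / δ) ^ i, by positivity, fun v hv => ?_⟩
  have hl : 0 ≤ Real.log v := Real.log_nonneg hv
  have h1 : 1 + Real.log v ≤ (1 + 1 / δ) * v ^ δ := by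
    have := Real.log_le_rpow_div (by linarith : 0 ≤ v) hδ0
    have h2 : 1 ≤ v ^ δ := Real.one_le_rpow hv hδ0.le
    rw [add_mul, one_div, ← div_eq_inv_mul]; linarith
  calc (1 + Real.log v) ^ i ≤ ((1 + 1 / δ) * v ^ δ) ^ i := by gcongr
    _ = (1 + 1 / δ) ^ i * v ^ (δ * i) := by
      rw [mul_pow, ← Real.rpow_natCast (v ^ δ), ← Real.rpow_mul (by linarith)]
    _ ≤ (1 + 1 / δ) ^ i * v ^ ε := by
      gcongr
      rw [hδ, div_mul_eq_mul_div, div_le_iff₀ (by positivity)]; nlinarith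

lemma log_pow_le' (ε : ℝ) (hε : 0 < ε) (i : ℕ) :
    ∃ C > (0:ℝ), (∀ v : ℝ, 1 ≤ v → (1 + |Real.log v|) ^ i ≤ C * v ^ ε) ∧
      (∀ v : ℝ, 0 < v → v ≤ 1 → (1 + |Real.log v|) ^ i ≤ C * v ^ (-ε)) := by
  obtain ⟨C, hC, h⟩ := log_pow_le ε hε i
  refine ⟨C, hC, fun v hv => ?_, fun v h0 hv => ?_⟩
  · rw [abs_of_nonneg (Real.log_nonneg hv)]; exact h v hv
  · have := h v⁻¹ ((one_le_inv₀ h0).2 hv)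
    rw [Real.log_inv, Real.inv_rpow h0.le, ← Real.rpow_neg h0.le] at this
    rwa [abs_of_nonpos (Real.log_nonpos h0.le hv)]

/-- The polynomials `Q_q` with `(x d/dx)^q e^{-x} = Q_q(x) e^{-x}`. -/
def Qp : ℕ → Polynomial ℝ
  | 0 => 1
  | q + 1 => Polynomial.X * (Polynomial.derivative (Qp q) - Qp q)

/-- `b_q(x) = Q_q(x) e^{-x}`. -/
def bq (q : ℕ) (x : ℝ) : ℝ := (Qp q).eval x * Real.exp (-x)

lemma bq_hasDerivAt (q : ℕ) (x : ℝ) :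
    HasDerivAt (bq q) ((Qp q).derivative.eval x * Real.exp (-x)
      - (Qp q).eval x * Real.exp (-x)) x := by
  have h1 := (Qp q).hasDerivAt x
  have h2 : HasDerivAt (fun x : ℝ => Real.exp (-x)) (-Real.exp (-x)) x := by
    simpa using (hasDerivAt_neg x).exp
  refine HasDerivAt.congr_deriv (h1.mul h2) ?_
  ring

lemma bq_succ (q : ℕ) (x : ℝ) : bq (q+1) x = x * ((Qp q).derivative.eval x * Real.exp (-x)
      - (Qp q).eval x * Real.exp (-x)) := by
  simp [bq, Qp]; ring

lemma bq_hasDerivAt' (q : ℕ) {x : ℝ} (hx : x ≠ 0) :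
    HasDerivAt (bq q) (bq (q+1) x / x) x := by
  refine HasDerivAt.congr_deriv (bq_hasDerivAt q x) ?_
  rw [bq_succ]; field_simp

lemma exp_poly_bound (P : Polynomial ℝ) (N : ℕ) :
    ∃ C > (0:ℝ), ∀ x : ℝ, 0 ≤ x → |P.eval x * Real.exp (-x)| * (1 + x) ^ N ≤ C := by
  obtain ⟨C, hC, h⟩ := poly_bound P
  set n := P.natDegree
  refine ⟨C * ((n + N).factorial * Real.exp 1), by positivity, fun x hx => ?_⟩
  have h1 := h x
  rw [abs_of_nonneg hx] at h1
  rw [abs_mul, abs_of_pos (Real.exp_pos _)]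
  have h2 := pow_le_fact_exp (n + N) (by linarith : 0 ≤ 1 + x)
  calc |P.eval x| * Real.exp (-x) * (1 + x) ^ N
      ≤ C * (1 + x) ^ n * Real.exp (-x) * (1 + x) ^ N := by gcongr
    _ = C * ((1 + x) ^ (n + N) * Real.exp (-x)) := by rw [pow_add]; ring
    _ ≤ C * ((n + N).factorial * Real.exp (1 + x) * Real.exp (-x)) := by gcongr
    _ = _ := by rw [Real.exp_add, Real.exp_neg]; field_simp

lemma bq_bound (q N : ℕ) : ∃ C > (0:ℝ), ∀ x : ℝ, 0 ≤ x → |bq q x| * (1 + x) ^ N ≤ C :=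
  exp_poly_bound (Qp q) N

lemma bq_bound_lin (q : ℕ) (hq : 1 ≤ q) : ∃ C > (0:ℝ), ∀ x : ℝ, 0 ≤ x → |bq q x| ≤ C * x := by
  obtain ⟨q, rfl⟩ : ∃ p, q = p + 1 := ⟨q - 1, by omega⟩
  obtain ⟨C, hC, h⟩ := exp_poly_bound ((Qp q).derivative - Qp q) 0
  refine ⟨C, hC, fun x hx => ?_⟩
  have := h x hx
  rw [bq_succ, abs_mul, abs_of_nonneg hx, mul_comm]
  gcongr
  rw [← sub_mul]
  simpa using this

/-- `B_{i,q}(α,u) = (ln u)^i b_q(u^α)`. -/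
def Bf (i q : ℕ) (α u : ℝ) : ℝ := Real.log u ^ i * bq q (u ^ α)

/-- Dominating function. -/
def dm (u : ℝ) : ℝ := min (u ^ (-(1/2) : ℝ)) (u ^ (-4 : ℝ))

lemma dm_le_one {u : ℝ} (h0 : 0 < u) (h1 : u ≤ 1) : dm u = u ^ (-(1/2) : ℝ) := by
  unfold dm
  rw [min_eq_left]
  exact Real.rpow_le_rpow_of_exponent_ge h0 h1 (by norm_num)

lemma dm_ge_one {u : ℝ} (h1 : 1 ≤ u) : dm u = u ^ (-4 : ℝ) := by
  unfold dm
  rw [min_eq_right]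
  exact Real.rpow_le_rpow_of_exponent_le h1 (by norm_num)

lemma dm_pos {u : ℝ} (h0 : 0 < u) : 0 < dm u := by
  unfold dm; positivity

lemma Bf_dm (i q : ℕ) (a : ℝ) (ha : 0 < a) :
    ∃ C > (0:ℝ), ∀ α : ℝ, a ≤ α → ∀ u : ℝ, 0 < u → |Bf i q α u| ≤ C * dm u := by
  obtain ⟨N, hN⟩ := exists_nat_ge (5 / a)
  obtain ⟨C1, hC1, h1⟩ := bq_bound q 0
  obtain ⟨C2, hC2, h2⟩ := bq_bound q N
  obtain ⟨L1, hL1, -, hl1⟩ := log_pow_le' (1/2) (by norm_num) i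
  obtain ⟨L2, hL2, hl2, -⟩ := log_pow_le' 1 (by norm_num) i
  have hNa : 5 ≤ a * N := by rw [div_le_iff₀ ha] at hN; linarith
  refine ⟨L1 * C1 + L2 * C2, by positivity, fun α hα u hu => ?_⟩
  have hx : 0 < u ^ α := Real.rpow_pos_of_pos hu _
  have hlog : |Real.log u ^ i| ≤ (1 + |Real.log u|) ^ i := by
    rw [abs_pow]; gcongr; linarith
  unfold Bf
  rw [abs_mul]
  rcases le_total u 1 with h | h
  · have e1 := hl1 u hu h
    have e2 := h1 _ hx.le
    rw [pow_zero, mul_one] at e2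
    rw [dm_le_one hu h]
    have h3 : 0 < u ^ (-(1/2) : ℝ) := by positivity
    calc |Real.log u ^ i| * |bq q (u ^ α)| ≤ (L1 * u ^ (-(1/2):ℝ)) * C1 := by
          gcongr; exact hlog.trans e1
      _ ≤ _ := by nlinarith [mul_pos hL2 hC2]
  · have e1 := hl2 u h
    have e2 := h2 _ hx.le
    rw [dm_ge_one h]
    have h3 : u ^ (5:ℝ) ≤ (1 + u ^ α) ^ N := by
      calc u ^ (5:ℝ) ≤ u ^ (α * N) := by
            apply Real.rpow_le_rpow_of_exponent_le h
            nlinarith [(Nat.cast_nonneg N : (0:ℝ) ≤ N)]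
        _ = (u ^ α) ^ N := by rw [Real.rpow_mul hu.le, Real.rpow_natCast]
        _ ≤ _ := by gcongr; linarith
    have h5 : 0 < u ^ (5:ℝ) := by positivity
    have e3 : |bq q (u ^ α)| ≤ C2 * u ^ (-5:ℝ) := by
      rw [Real.rpow_neg hu.le, ← div_eq_mul_inv, le_div_iff₀ h5]
      exact (mul_le_mul_of_nonneg_left h3 (abs_nonneg _)).trans e2
    have h4 : 0 < u ^ (-4 : ℝ) := by positivity
    calc |Real.log u ^ i| * |bq q (u ^ α)| ≤ (L2 * u ^ (1:ℝ)) * (C2 * u ^ (-5:ℝ)) := by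
          gcongr; exact hlog.trans e1
      _ = L2 * C2 * u ^ (-4:ℝ) := by
          rw [mul_mul_mul_comm, ← Real.rpow_add hu]; norm_num
      _ ≤ _ := by nlinarith [mul_pos hL1 hC1]

lemma Bf_pow (i q m : ℕ) (hq : 1 ≤ q) (hi : i ≤ m) :
    ∃ C > (0:ℝ), ∀ α u : ℝ, 0 < u → |Bf i q α u| ≤ C * (u ^ α * (1 + |Real.log u|) ^ m) := by
  obtain ⟨C, hC, h⟩ := bq_bound_lin q hq
  refine ⟨C, hC, fun α u hu => ?_⟩
  have hx : 0 < u ^ α := Real.rpow_pos_of_pos hu _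
  have e := h _ hx.le
  have h1 : (1:ℝ) ≤ 1 + |Real.log u| := by linarith [abs_nonneg (Real.log u)]
  have hlog : |Real.log u ^ i| ≤ (1 + |Real.log u|) ^ m := by
    rw [abs_pow]
    calc |Real.log u| ^ i ≤ (1 + |Real.log u|) ^ i := by gcongr; linarith
      _ ≤ _ := pow_le_pow_right₀ h1 hi
  unfold Bf
  rw [abs_mul]
  calc _ ≤ (1 + |Real.log u|) ^ m * (C * u ^ α) := by gcongr
    _ = _ := by ring

lemma Bf_hasDerivAt (i q : ℕ) (α u : ℝ) (hu : 0 < u) :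
    HasDerivAt (Bf i q α) ((i * Bf (i-1) q α u + α * Bf i (q+1) α u) / u) u := by
  have hx : 0 < u ^ α := Real.rpow_pos_of_pos hu _
  have h1 := (Real.hasDerivAt_log hu.ne').pow i
  have h2 := (bq_hasDerivAt' q hx.ne').comp u (Real.hasDerivAt_rpow_const (p := α) (Or.inl hu.ne'))
  refine HasDerivAt.congr_deriv (h1.mul h2) ?_
  unfold Bf
  simp only [Pi.pow_apply]
  rw [Real.rpow_sub_one hu.ne']
  field_simp

lemma Bf_hasDerivAt_alpha (i q : ℕ) (α u : ℝ) (hu : 0 < u) :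
    HasDerivAt (fun a => Bf i q a u) (Bf (i+1) (q+1) α u) α := by
  have hx : 0 < u ^ α := Real.rpow_pos_of_pos hu _
  have h3 : HasDerivAt (fun a : ℝ => u ^ a) (u ^ α * Real.log u) α := by
    simpa using (Real.hasStrictDerivAt_const_rpow hu α).hasDerivAt
  have h2 := ((bq_hasDerivAt' q hx.ne').comp α h3).const_mul (Real.log u ^ i)
  refine HasDerivAt.congr_deriv (h2) ?_
  unfold Bf
  field_simp
  ring

/-- The span of the `B_{i,q}` with `i ≤ m`, `q ≥ 1`, coefficients polynomial in `α`. -/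
inductive GB (m : ℕ) : (ℝ → ℝ → ℝ) → Prop
  | base (i q : ℕ) (hi : i ≤ m) (hq : 1 ≤ q) : GB m (Bf i q)
  | add (G H : ℝ → ℝ → ℝ) : GB m G → GB m H → GB m (fun α u => G α u + H α u)
  | const (c : ℝ) (G : ℝ → ℝ → ℝ) : GB m G → GB m (fun α u => c * G α u)
  | alpha (G : ℝ → ℝ → ℝ) : GB m G → GB m (fun α u => α * G α u)

lemma GB.theta {m : ℕ} {G : ℝ → ℝ → ℝ} (h : GB m G) :
    ∃ G', GB m G' ∧ ∀ α u : ℝ, 0 < u → HasDerivAt (G α) (G' α u / u) u := by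
  induction h with
  | base i q hi hq =>
    exact ⟨_, .add _ _ (.const i _ (.base (i-1) q (by omega) hq))
      (.alpha _ (.base i (q+1) hi (by omega))), fun α u hu => Bf_hasDerivAt i q α u hu⟩
  | add G H _ _ ihG ihH =>
    obtain ⟨G', hG, hG'⟩ := ihG
    obtain ⟨H', hH, hH'⟩ := ihH
    refine ⟨_, .add _ _ hG hH, fun α u hu => ?_⟩
    refine HasDerivAt.congr_deriv ((hG' α u hu).add (hH' α u hu)) ?_
    ring
  | const c G _ ihG =>
    obtain ⟨G', hG, hG'⟩ := ihG
    refine ⟨_, .const c _ hG, fun α u hu => ?_⟩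
    refine HasDerivAt.congr_deriv ((hG' α u hu).const_mul c) ?_
    ring
  | alpha G _ ihG =>
    obtain ⟨G', hG, hG'⟩ := ihG
    refine ⟨_, .alpha _ hG, fun α u hu => ?_⟩
    refine HasDerivAt.congr_deriv ((hG' α u hu).const_mul α) ?_
    ring

lemma GB.bound {m : ℕ} {G : ℝ → ℝ → ℝ} (h : GB m G) (a b : ℝ) (ha : 0 < a) :
    ∃ C > (0:ℝ), ∀ α ∈ Icc a b, ∀ u : ℝ, 0 < u → |G α u| ≤ C * dm u ∧
      |G α u| ≤ C * (u ^ α * (1 + |Real.log u|) ^ m) := by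
  induction h with
  | base i q hi hq =>
    obtain ⟨C, hC, h⟩ := Bf_dm i q a ha
    obtain ⟨C', hC', h'⟩ := Bf_pow i q m hq hi
    refine ⟨C + C', by positivity, fun α hα u hu => ⟨?_, ?_⟩⟩
    · exact (h α hα.1 u hu).trans (by have := dm_pos hu; nlinarith)
    · have : 0 < u ^ α * (1 + |Real.log u|) ^ m := by positivity
      exact (h' α u hu).trans (by nlinarith)
  | add G H _ _ ihG ihH =>
    obtain ⟨C, hC, h⟩ := ihG
    obtain ⟨C', hC', h'⟩ := ihH
    refine ⟨C + C', by positivity, fun α hα u hu => ⟨?_, ?_⟩⟩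
    · have := (h α hα u hu).1; have := (h' α hα u hu).1
      refine (abs_add_le _ _).trans ?_; linarith
    · have := (h α hα u hu).2; have := (h' α hα u hu).2
      refine (abs_add_le _ _).trans ?_; linarith
  | const c G _ ihG =>
    obtain ⟨C, hC, h⟩ := ihG
    refine ⟨(|c| + 1) * C, by positivity, fun α hα u hu => ⟨?_, ?_⟩⟩
    · have h1 := (h α hα u hu).1
      have := dm_pos hu
      rw [abs_mul, mul_assoc]; gcongr; linarith
    · have h1 := (h α hα u hu).2
      rw [abs_mul, mul_assoc]; gcongr; linarith
  | alpha G _ ihG =>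
    obtain ⟨C, hC, h⟩ := ihG
    refine ⟨(|b| + 1) * C, by positivity, fun α hα u hu => ?_⟩
    have hαb : |α| ≤ |b| + 1 := by
      have := hα.1; have := hα.2
      rw [abs_of_pos (by linarith), abs_of_pos (by linarith)]; linarith
    constructor
    · have h1 := (h α hα u hu).1
      have := dm_pos hu
      rw [abs_mul, mul_assoc]; gcongr
    · have h1 := (h α hα u hu).2
      rw [abs_mul, mul_assoc]; gcongr


/-! ### Part 2: cosine transforms -/

lemma integrableOn_Ioi_split {f : ℝ → ℝ} (h1 : IntegrableOn f (Ioc 0 1)) (h2 : IntegrableOn f (Ioi 1)) :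
    IntegrableOn f (Ioi 0) := by
  rw [← Ioc_union_Ioi_eq_Ioi (zero_le_one : (0:ℝ) ≤ 1)]
  exact h1.union h2

lemma rpow_integrableOn_Ioc {r : ℝ} (hr : -1 < r) : IntegrableOn (fun u : ℝ => u ^ r) (Ioc 0 1) := by
  rw [← intervalIntegrable_iff_integrableOn_Ioc_of_le zero_le_one]
  exact intervalIntegral.intervalIntegrable_rpow' hr

lemma dm_integrable : IntegrableOn dm (Ioi 0) := by
  refine integrableOn_Ioi_split ?_ ?_
  · exact (rpow_integrableOn_Ioc (r := -(1/2)) (by norm_num)).congr_fun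
      (fun u hu => (dm_le_one hu.1 hu.2).symm) measurableSet_Ioc
  · exact (integrableOn_Ioi_rpow_of_lt (a := -4) (by norm_num) one_pos).congr_fun
      (fun u hu => (dm_ge_one (le_of_lt hu)).symm) measurableSet_Ioi

lemma dm_mul_le_one {u : ℝ} (h0 : 0 < u) (h1 : u ≤ 1) : u * dm u = u ^ (1/2 : ℝ) := by
  rw [dm_le_one h0 h1]
  nth_rw 1 [← Real.rpow_one u]
  rw [← Real.rpow_add h0]; norm_num

lemma dm_mul_ge_one {u : ℝ} (h1 : 1 ≤ u) : u * dm u = u ^ (-3 : ℝ) := by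
  rw [dm_ge_one h1]
  nth_rw 1 [← Real.rpow_one u]
  rw [← Real.rpow_add (by linarith)]; norm_num

lemma mul_dm_integrable : IntegrableOn (fun u => u * dm u) (Ioi 0) := by
  refine integrableOn_Ioi_split ?_ ?_
  · exact (rpow_integrableOn_Ioc (r := (1/2)) (by norm_num)).congr_fun
      (fun u hu => (dm_mul_le_one hu.1 hu.2).symm) measurableSet_Ioc
  · exact (integrableOn_Ioi_rpow_of_lt (a := -3) (by norm_num) one_pos).congr_fun
      (fun u hu => (dm_mul_ge_one (le_of_lt hu)).symm) measurableSet_Ioi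

lemma mul_dm_tendsto_zero : Tendsto (fun u => u * dm u) (𝓝[>] 0) (𝓝 0) := by
  have h : Tendsto (fun u : ℝ => u ^ (1/2 : ℝ)) (𝓝[>] 0) (𝓝 0) := by
    have : ContinuousAt (fun u : ℝ => u ^ (1/2 : ℝ)) 0 :=
      Real.continuousAt_rpow_const _ _ (Or.inr (by norm_num))
    have h2 := this.tendsto
    rw [Real.zero_rpow (by norm_num)] at h2
    exact h2.mono_left nhdsWithin_le_nhds
  refine h.congr' ?_
  filter_upwards [Ioo_mem_nhdsGT (zero_lt_one : (0:ℝ) < 1)] with u hu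
  exact (dm_mul_le_one hu.1 hu.2.le).symm

lemma mul_dm_tendsto_atTop : Tendsto (fun u => u * dm u) atTop (𝓝 0) := by
  refine (tendsto_rpow_neg_atTop (y := 3) (by norm_num)).congr' ?_
  filter_upwards [eventually_ge_atTop 1] with u hu
  exact (dm_mul_ge_one hu).symm

lemma dm_tendsto_atTop : Tendsto dm atTop (𝓝 0) := by
  refine (tendsto_rpow_neg_atTop (y := 4) (by norm_num)).congr' ?_
  filter_upwards [eventually_ge_atTop 1] with u hu
  exact (dm_ge_one hu).symm

lemma adm_int {G : ℝ → ℝ} {C : ℝ} (hc : ContinuousOn G (Ioi 0)) (hb : ∀ u, 0 < u → |G u| ≤ C * dm u) :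
    IntegrableOn G (Ioi 0) := by
  refine Integrable.mono' (dm_integrable.const_mul C) (hc.aestronglyMeasurable measurableSet_Ioi) ?_
  exact ae_restrict_of_forall_mem measurableSet_Ioi fun u hu => hb u hu

lemma adm_int_mul {G : ℝ → ℝ} {C : ℝ} (hc : ContinuousOn G (Ioi 0)) (hb : ∀ u, 0 < u → |G u| ≤ C * (u * dm u)) :
    IntegrableOn G (Ioi 0) := by
  refine Integrable.mono' (mul_dm_integrable.const_mul C) (hc.aestronglyMeasurable measurableSet_Ioi) ?_
  exact ae_restrict_of_forall_mem measurableSet_Ioi fun u hu => hb u hu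

/-- Half-line cosine transform. -/
def Tf (G : ℝ → ℝ) (z : ℝ) : ℝ := ∫ u in Ioi (0:ℝ), Real.cos (z * u) * G u

lemma Tf_neg (G : ℝ → ℝ) (z : ℝ) : Tf G (-z) = Tf G z := by
  unfold Tf; simp [neg_mul, Real.cos_neg]

lemma cos_mul_le (x y : ℝ) : |Real.cos x * y| ≤ |y| := by
  rw [abs_mul]; exact mul_le_of_le_one_left (abs_nonneg _) (Real.abs_cos_le_one x)

lemma sin_mul_le (x y : ℝ) : |Real.sin x * y| ≤ |y| := by
  rw [abs_mul]; exact mul_le_of_le_one_left (abs_nonneg _) (Real.abs_sin_le_one x)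

lemma Tf_bound {G : ℝ → ℝ} {C : ℝ} (hb : ∀ u, 0 < u → |G u| ≤ C * dm u) (z : ℝ) :
    |Tf G z| ≤ C * ∫ u in Ioi (0:ℝ), dm u := by
  unfold Tf
  rw [← integral_const_mul, ← Real.norm_eq_abs]
  refine norm_integral_le_of_norm_le (dm_integrable.const_mul C) ?_
  exact ae_restrict_of_forall_mem measurableSet_Ioi fun u hu => (cos_mul_le _ _).trans (hb u hu)

lemma Tf_const_mul (c : ℝ) (G : ℝ → ℝ) (z : ℝ) : Tf (fun u => c * G u) z = c * Tf G z := by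
  unfold Tf
  rw [← integral_const_mul]
  congr 1; ext u; ring

lemma Tf_hasDerivAt {G : ℝ → ℝ} {C : ℝ} (hc : ContinuousOn G (Ioi 0))
    (hb : ∀ u, 0 < u → |G u| ≤ C * dm u) (z : ℝ) :
    HasDerivAt (Tf G) (∫ u in Ioi (0:ℝ), -Real.sin (z * u) * u * G u) z := by
  have hcont : ∀ z : ℝ, ContinuousOn (fun u => Real.cos (z * u) * G u) (Ioi 0) := fun z =>
    ContinuousOn.mul (by fun_prop) hc
  have hcont' : ∀ z : ℝ, ContinuousOn (fun u => -Real.sin (z * u) * u * G u) (Ioi 0) := fun z =>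
    ContinuousOn.mul (by fun_prop) hc
  refine (hasDerivAt_integral_of_dominated_loc_of_deriv_le (s := univ) (bound := fun u => C * (u * dm u))
    (F := fun z u => Real.cos (z * u) * G u) (F' := fun z u => -Real.sin (z * u) * u * G u)
    univ_mem ?_ ?_ ?_ ?_ ?_ ?_).2
  · exact Eventually.of_forall fun z => (hcont z).aestronglyMeasurable measurableSet_Ioi
  · exact adm_int (hcont z) fun u hu => (cos_mul_le _ _).trans (hb u hu)
  · exact (hcont' z).aestronglyMeasurable measurableSet_Ioi
  · refine ae_restrict_of_forall_mem measurableSet_Ioi fun u hu z _ => ?_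
    rw [Real.norm_eq_abs, neg_mul, neg_mul, abs_neg, mul_assoc]
    refine (sin_mul_le _ _).trans ?_
    rw [abs_mul, abs_of_pos hu]
    have := hb u hu
    have hu' : 0 < u := hu
    nlinarith
  · exact mul_dm_integrable.const_mul C
  · refine ae_restrict_of_forall_mem measurableSet_Ioi fun u hu z _ => ?_
    have : HasDerivAt (fun z => Real.cos (z * u)) (-Real.sin (z * u) * u) z := by
      simpa using ((hasDerivAt_id z).mul_const u).cos
    exact this.mul_const _

lemma Tf_Dop {G G' : ℝ → ℝ} {C : ℝ} (hd : ∀ u, 0 < u → HasDerivAt G (G' u / u) u)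
    (hb : ∀ u, 0 < u → |G u| ≤ C * dm u) (hc' : ContinuousOn G' (Ioi 0))
    (hb' : ∀ u, 0 < u → |G' u| ≤ C * dm u) (z : ℝ) :
    Dop (Tf G) z = - Tf G' z := by
  have hc : ContinuousOn G (Ioi 0) := fun u hu => (hd u hu).continuousAt.continuousWithinAt
  unfold Dop
  rw [(Tf_hasDerivAt hc hb z).deriv]
  have i1 : IntegrableOn (fun u => Real.cos (z * u) * G u) (Ioi 0) :=
    adm_int (ContinuousOn.mul (by fun_prop) hc) fun u hu => (cos_mul_le _ _).trans (hb u hu)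
  have i2 : IntegrableOn (fun u => Real.cos (z * u) * G' u) (Ioi 0) :=
    adm_int (ContinuousOn.mul (by fun_prop) hc') fun u hu => (cos_mul_le _ _).trans (hb' u hu)
  have i3 : IntegrableOn (fun u => -Real.sin (z * u) * u * G u) (Ioi 0) := by
    refine adm_int_mul (C := C) (ContinuousOn.mul (by fun_prop) hc) fun u hu => ?_
    rw [neg_mul, neg_mul, abs_neg, mul_assoc]
    refine (sin_mul_le _ _).trans ?_
    rw [abs_mul, abs_of_pos hu]
    have := hb u hu
    nlinarith
  set P : ℝ → ℝ := fun u => Real.cos (z * u) * (u * G u) with hP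
  have hPb : ∀ u, 0 < u → ‖P u‖ ≤ C * (u * dm u) := by
    intro u hu
    refine (cos_mul_le _ _).trans ?_
    rw [abs_mul, abs_of_pos hu]
    have := hb u hu
    nlinarith
  have hPd : ∀ u ∈ Ioi (0:ℝ), HasDerivAt P (Real.cos (z * u) * G u + Real.cos (z * u) * G' u
      + z * (-Real.sin (z * u) * u * G u)) u := by
    intro u hu
    have hu' : 0 < u := hu
    have h1 : HasDerivAt (fun u => Real.cos (z * u)) (-Real.sin (z * u) * z) u := by
      simpa using ((hasDerivAt_id u).const_mul z).cos
    refine HasDerivAt.congr_deriv (h1.mul ((hasDerivAt_id u).mul (hd u hu))) ?_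
    simp only [id]
    field_simp
    ring
  have hPc : ContinuousWithinAt P (Ici 0) 0 := by
    have hP0 : P 0 = 0 := by simp [hP]
    rw [← continuousWithinAt_Ioi_iff_Ici, ContinuousWithinAt, hP0]
    refine squeeze_zero_norm' (a := fun u => C * (u * dm u)) ?_ ?_
    · filter_upwards [self_mem_nhdsWithin] with u hu using hPb u hu
    · simpa using mul_dm_tendsto_zero.const_mul C
  have hPt : Tendsto P atTop (𝓝 0) := by
    refine squeeze_zero_norm' (a := fun u => C * (u * dm u)) ?_ ?_
    · filter_upwards [eventually_gt_atTop 0] with u hu using hPb u hu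
    · simpa using mul_dm_tendsto_atTop.const_mul C
  have key := integral_Ioi_of_hasDerivAt_of_tendsto hPc hPd ((i1.add i2).add (i3.const_mul z)) hPt
  have hP0 : P 0 = 0 := by simp [hP]
  have i12 : IntegrableOn (fun u => Real.cos (z * u) * G u + Real.cos (z * u) * G' u) (Ioi 0) :=
    i1.add i2
  rw [hP0, integral_add i12 (i3.const_mul z), integral_add i1 i2, integral_const_mul] at key
  unfold Tf
  linarith

lemma Tf_alpha (i q : ℕ) (z α : ℝ) (hα : 0 < α) :
    HasDerivAt (fun a => Tf (Bf i q a) z) (Tf (Bf (i+1) (q+1) α) z) α := by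
  obtain ⟨C, hC, hb⟩ := Bf_dm i q (α/2) (by positivity)
  obtain ⟨C', hC', hb'⟩ := Bf_dm (i+1) (q+1) (α/2) (by positivity)
  have hcB : ∀ i q a, ContinuousOn (Bf i q a) (Ioi 0) := fun i q a u hu =>
    (Bf_hasDerivAt i q a u hu).continuousAt.continuousWithinAt
  have hc : ∀ i q a, ContinuousOn (fun u => Real.cos (z * u) * Bf i q a u) (Ioi 0) := fun i q a =>
    ContinuousOn.mul (by fun_prop) (hcB i q a)
  refine (hasDerivAt_integral_of_dominated_loc_of_deriv_le (s := Ioi (α/2)) (bound := fun u => C' * dm u)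
    (F := fun a u => Real.cos (z * u) * Bf i q a u)
    (F' := fun a u => Real.cos (z * u) * Bf (i+1) (q+1) a u)
    (Ioi_mem_nhds (by linarith)) ?_ ?_ ?_ ?_ ?_ ?_).2
  · exact Eventually.of_forall fun a => (hc i q a).aestronglyMeasurable measurableSet_Ioi
  · exact adm_int (hc i q α) fun u hu => (cos_mul_le _ _).trans (hb α (by linarith) u hu)
  · exact (hc _ _ α).aestronglyMeasurable measurableSet_Ioi
  · exact ae_restrict_of_forall_mem measurableSet_Ioi fun u hu a ha =>
      (cos_mul_le _ _).trans (hb' a (le_of_lt ha) u hu)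
  · exact dm_integrable.const_mul C'
  · exact ae_restrict_of_forall_mem measurableSet_Ioi fun u hu a ha =>
      (Bf_hasDerivAt_alpha i q a u hu).const_mul _


/-! ### Part 3: tail bounds of cosine transforms -/

lemma osc_bound {G0 G1 G2 G3 : ℝ → ℝ} {C A p s : ℝ} (hp : 0 < p) (hs : s < 2)
    (hd0 : ∀ u, 0 < u → HasDerivAt G0 (G1 u / u) u)
    (hd1 : ∀ u, 0 < u → HasDerivAt G1 (G2 u / u) u)
    (hd2 : ∀ u, 0 < u → HasDerivAt G2 (G3 u / u) u)
    (hc3 : ContinuousOn G3 (Ioi 0))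
    (hb0 : ∀ u, 0 < u → |G0 u| ≤ C * dm u)
    (hb1 : ∀ u, 0 < u → |G1 u| ≤ C * dm u)
    (hb2 : ∀ u, 0 < u → |G2 u| ≤ C * dm u)
    (hs1 : ∀ u, 0 < u → u ≤ 1 → |G1 u| ≤ A * u ^ p)
    (hl1 : ∀ u, 1 ≤ u → |G1 u| ≤ A * u ^ s)
    (hl2 : ∀ u, 1 ≤ u → |G2 u| ≤ A * u ^ s)
    (hl3 : ∀ u, 1 ≤ u → |G3 u| ≤ A * u ^ s) :
    |∫ u in Ioi (0:ℝ), Real.cos u * G0 u| ≤ A * (1 / p + 3 + 6 / (2 - s)) := by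
  have hc0 : ContinuousOn G0 (Ioi 0) := fun u hu => (hd0 u hu).continuousAt.continuousWithinAt
  have hc1 : ContinuousOn G1 (Ioi 0) := fun u hu => (hd1 u hu).continuousAt.continuousWithinAt
  have hc2 : ContinuousOn G2 (Ioi 0) := fun u hu => (hd2 u hu).continuousAt.continuousWithinAt
  have i0 : IntegrableOn (fun u => Real.cos u * G0 u) (Ioi 0) :=
    adm_int (ContinuousOn.mul (by fun_prop) hc0) fun u hu => (cos_mul_le _ _).trans (hb0 u hu)
  have i0a : IntegrableOn (fun u => Real.cos u * G0 u) (Ioc 0 1) := i0.mono_set Ioc_subset_Ioi_self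
  have i0b : IntegrableOn (fun u => Real.cos u * G0 u) (Ioi 1) :=
    i0.mono_set (Ioi_subset_Ioi zero_le_one)
  have hsub1 : Ioc (0:ℝ) 1 ⊆ Ioi 0 := Ioc_subset_Ioi_self
  have hsub2 : Ioi (1:ℝ) ⊆ Ioi 0 := Ioi_subset_Ioi zero_le_one
  -- small part
  have bs : ∀ u ∈ Ioc (0:ℝ) 1, ‖Real.sin u * (G1 u / u)‖ ≤ A * u ^ (p - 1) := by
    intro u hu
    refine (sin_mul_le _ _).trans ?_
    rw [abs_div, abs_of_pos hu.1, Real.rpow_sub_one hu.1.ne', mul_div_assoc']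
    have := hu.1
    gcongr
    exact hs1 u hu.1 hu.2
  have m1 : ContinuousOn (fun u => Real.sin u * (G1 u / u)) (Ioi 0) :=
    ContinuousOn.mul (by fun_prop) (hc1.div continuousOn_id fun u hu => ne_of_gt hu)
  have ip : IntegrableOn (fun u : ℝ => A * u ^ (p - 1)) (Ioc 0 1) :=
    (rpow_integrableOn_Ioc (by linarith)).const_mul A
  have i1 : IntegrableOn (fun u => Real.sin u * (G1 u / u)) (Ioc 0 1) := by
    refine Integrable.mono' ip ((m1.mono hsub1).aestronglyMeasurable measurableSet_Ioc) ?_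
    exact ae_restrict_of_forall_mem measurableSet_Ioc bs
  have e1 : ∫ u in Ioc (0:ℝ) 1, (Real.cos u * G0 u + Real.sin u * (G1 u / u))
      = Real.sin 1 * G0 1 - 0 := by
    rw [← intervalIntegral.integral_of_le zero_le_one]
    refine intervalIntegral.integral_eq_sub_of_hasDerivAt_of_tendsto zero_lt_one
      (f := fun u => Real.sin u * G0 u) ?_ ?_ ?_ ?_
    · intro u hu
      exact (Real.hasDerivAt_sin u).mul (hd0 u hu.1)
    · rw [intervalIntegrable_iff_integrableOn_Ioc_of_le zero_le_one]
      exact i0a.add i1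
    · refine squeeze_zero_norm' (a := fun u => C * (u * dm u)) ?_ ?_
      · filter_upwards [self_mem_nhdsWithin] with u hu
        have hu' : 0 < u := hu
        rw [norm_mul]
        have h1 : |Real.sin u| ≤ |u| := Real.abs_sin_le_abs
        rw [abs_of_pos hu'] at h1
        calc ‖Real.sin u‖ * ‖G0 u‖ ≤ u * (C * dm u) :=
              mul_le_mul h1 (hb0 u hu) (norm_nonneg _) hu'.le
          _ = _ := by ring
      · simpa using mul_dm_tendsto_zero.const_mul C
    · have : ContinuousAt (fun u => Real.sin u * G0 u) 1 :=
        Real.continuous_sin.continuousAt.mul (hd0 1 one_pos).continuousAt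
      exact this.tendsto.mono_left nhdsWithin_le_nhds
  rw [integral_add i0a i1] at e1
  have n1 : ‖∫ u in Ioc (0:ℝ) 1, Real.sin u * (G1 u / u)‖ ≤ A * (1 / p) := by
    refine (norm_integral_le_of_norm_le ip
      (ae_restrict_of_forall_mem measurableSet_Ioc bs)).trans ?_
    rw [integral_const_mul, ← intervalIntegral.integral_of_le zero_le_one,
      integral_rpow (Or.inl (by linarith))]
    simp [hp.ne']
  -- large part
  set H : ℝ → ℝ := fun u => Real.sin u * ((G3 u - 3 * G2 u + 2 * G1 u) / u ^ 3) with hH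
  have bl : ∀ u ∈ Ioi (1:ℝ), ‖H u‖ ≤ 6 * A * u ^ (s - 3) := by
    intro u hu
    have hu1 : 1 < u := hu
    have hu0 : 0 < u := by linarith
    refine (sin_mul_le _ _).trans ?_
    rw [abs_div, abs_of_pos (pow_pos hu0 3), Real.rpow_sub hu0, mul_div_assoc']
    have e3 : u ^ (3:ℝ) = u ^ 3 := by exact_mod_cast Real.rpow_natCast u 3
    rw [e3]
    gcongr
    have h1 := abs_le.1 (hl1 u hu1.le); have h2 := abs_le.1 (hl2 u hu1.le)
    have h3 := abs_le.1 (hl3 u hu1.le)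
    rw [abs_le]; constructor <;> linarith
  have mH : ContinuousOn H (Ioi 0) := by
    refine ContinuousOn.mul (by fun_prop) (ContinuousOn.div (by fun_prop) (by fun_prop) ?_)
    intro u hu
    have : 0 < u := hu
    positivity
  have iq : IntegrableOn (fun u : ℝ => 6 * A * u ^ (s - 3)) (Ioi 1) :=
    (integrableOn_Ioi_rpow_of_lt (by linarith) one_pos).const_mul _
  have iH : IntegrableOn H (Ioi 1) := by
    refine Integrable.mono' iq ((mH.mono hsub2).aestronglyMeasurable measurableSet_Ioi) ?_
    exact ae_restrict_of_forall_mem measurableSet_Ioi bl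
  have n2 : ‖∫ u in Ioi (1:ℝ), H u‖ ≤ A * (6 / (2 - s)) := by
    refine (norm_integral_le_of_norm_le iq
      (ae_restrict_of_forall_mem measurableSet_Ioi bl)).trans ?_
    rw [integral_const_mul, integral_Ioi_rpow_of_lt (by linarith) one_pos]
    simp only [Real.one_rpow]
    have : -1 / (s - 3 + 1) = 1 / (2 - s) := by
      rw [div_eq_div_iff (by linarith) (by linarith)]; ring
    rw [this]
    apply le_of_eq; ring
  set P : ℝ → ℝ := fun u => Real.sin u * G0 u + Real.cos u * (G1 u / u)
    - Real.sin u * ((G2 u - G1 u) / u ^ 2) with hP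
  have hPd : ∀ u ∈ Ici (1:ℝ), HasDerivAt P (Real.cos u * G0 u - H u) u := by
    intro u hu
    have hu1 : (1:ℝ) ≤ u := hu
    have hu0 : 0 < u := by linarith
    have a0 := (Real.hasDerivAt_sin u).mul (hd0 u hu0)
    have a1 := (Real.hasDerivAt_cos u).mul ((hd1 u hu0).div (hasDerivAt_id u) hu0.ne')
    have a2 := (Real.hasDerivAt_sin u).mul (((hd2 u hu0).sub (hd1 u hu0)).div
      ((hasDerivAt_id u).pow 2) (by simp [hu0.ne']))
    refine HasDerivAt.congr_deriv ((a0.add a1).sub a2) ?_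
    simp only [hH, id, Pi.sub_apply, Pi.pow_apply, Pi.div_apply]
    field_simp
    push_cast
    ring
  have tt : ∀ {G : ℝ → ℝ}, (∀ u, 0 < u → |G u| ≤ C * dm u) → Tendsto G atTop (𝓝 0) := by
    intro G hG
    refine squeeze_zero_norm' (a := fun u => C * dm u) ?_ ?_
    · filter_upwards [eventually_gt_atTop 0] with u hu using hG u hu
    · simpa using dm_tendsto_atTop.const_mul C
  have hPt : Tendsto P atTop (𝓝 0) := by
    have t := ((tt hb0).norm.add (tt hb1).norm).add ((tt hb2).norm.add (tt hb1).norm)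
    simp only [norm_zero, add_zero] at t
    refine squeeze_zero_norm' ?_ t
    filter_upwards [eventually_ge_atTop 1] with u hu
    have hu0 : 0 < u := by linarith
    have b0 := sin_mul_le u (G0 u)
    have b1 := cos_mul_le u (G1 u / u)
    have b2 := sin_mul_le u ((G2 u - G1 u) / u ^ 2)
    have c1 : |G1 u / u| ≤ |G1 u| := by
      rw [abs_div, abs_of_pos hu0]; exact div_le_self (abs_nonneg _) hu
    have c2 : |(G2 u - G1 u) / u ^ 2| ≤ |G2 u| + |G1 u| := by
      rw [abs_div, abs_of_pos (pow_pos hu0 2)]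
      exact (div_le_self (abs_nonneg _) (one_le_pow₀ hu)).trans (abs_sub _ _)
    simp only [Real.norm_eq_abs, hP]
    refine (abs_sub _ _).trans ?_
    have := abs_add_le (Real.sin u * G0 u) (Real.cos u * (G1 u / u))
    linarith
  have e2 := integral_Ioi_of_hasDerivAt_of_tendsto' hPd (i0b.sub iH) hPt
  rw [integral_sub i0b iH] at e2
  have tot : ∫ u in Ioi (0:ℝ), Real.cos u * G0 u
      = (∫ u in Ioc (0:ℝ) 1, Real.cos u * G0 u) + ∫ u in Ioi (1:ℝ), Real.cos u * G0 u := by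
    rw [← Ioc_union_Ioi_eq_Ioi (zero_le_one : (0:ℝ) ≤ 1)]
    exact setIntegral_union (Ioc_disjoint_Ioi le_rfl) measurableSet_Ioi i0a i0b
  have p1 : P 1 = Real.sin 1 * G0 1 + Real.cos 1 * G1 1 - Real.sin 1 * (G2 1 - G1 1) := by
    simp [hP]
  rw [p1] at e2
  have q1 := hl1 1 le_rfl
  have q2 := hl2 1 le_rfl
  rw [Real.one_rpow, mul_one] at q1 q2
  have r1 := (cos_mul_le 1 (G1 1)).trans q1
  have r2 := (sin_mul_le 1 (G2 1 - G1 1)).trans ((abs_sub _ _).trans (add_le_add q2 q1))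
  rw [Real.norm_eq_abs] at n1 n2
  have n1' := abs_le.1 n1; have n2' := abs_le.1 n2
  have r1' := abs_le.1 r1; have r2' := abs_le.1 r2
  rw [tot, abs_le]
  constructor <;> linarith

lemma tail_scaled (a b : ℝ) (ha : 0 < a) (hb : b < 2) (m : ℕ) : ∃ M > (0:ℝ),
    ∀ α ∈ Icc a b, ∀ (G0 G1 G2 G3 : ℝ → ℝ) (C : ℝ), 0 < C →
    (∀ u, 0 < u → HasDerivAt G0 (G1 u / u) u) →
    (∀ u, 0 < u → HasDerivAt G1 (G2 u / u) u) →
    (∀ u, 0 < u → HasDerivAt G2 (G3 u / u) u) →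
    (ContinuousOn G3 (Ioi 0)) →
    (∀ u, 0 < u → |G0 u| ≤ C * dm u) →
    (∀ u, 0 < u → |G1 u| ≤ C * dm u) →
    (∀ u, 0 < u → |G2 u| ≤ C * dm u) →
    (∀ u, 0 < u → |G1 u| ≤ C * (u ^ α * (1 + |Real.log u|) ^ m)) →
    (∀ u, 0 < u → |G2 u| ≤ C * (u ^ α * (1 + |Real.log u|) ^ m)) →
    (∀ u, 0 < u → |G3 u| ≤ C * (u ^ α * (1 + |Real.log u|) ^ m)) →
    ∀ z, 1 ≤ z → |Tf G0 z| ≤ C * M * (z ^ (-(α + 1)) * (1 + Real.log z) ^ m) := by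
  set ε := min (a / 2) ((2 - b) / 2) with hε
  rcases lt_or_ge b a with hab | hab
  · exact ⟨1, one_pos, fun α hα => absurd (hα.1.trans hα.2) (not_le.2 hab)⟩
  have hε0 : 0 < ε := lt_min (by linarith) (by linarith)
  have hεa : ε ≤ a / 2 := min_le_left _ _
  have hεb : ε ≤ (2 - b) / 2 := min_le_right _ _
  obtain ⟨L, hL, hL1, hL2⟩ := log_pow_le' ε hε0 m
  have hs : b + ε < 2 := by linarith
  have hp : 0 < a - ε := by linarith
  refine ⟨L * (1 / (a - ε) + 3 + 6 / (2 - (b + ε))), ?_, ?_⟩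
  · have : 0 < 2 - (b + ε) := by linarith
    positivity
  intro α hα G0 G1 G2 G3 C hC hd0 hd1 hd2 hc3 hb0 hb1 hb2 hg1 hg2 hg3 z hz
  have hz0 : 0 < z := by linarith
  have hzi : 0 < z⁻¹ := inv_pos.2 hz0
  have hlz : 0 ≤ Real.log z := Real.log_nonneg hz
  -- scaled log bounds
  have logb : ∀ v, 0 < v → (z⁻¹ * v) ^ α * (1 + |Real.log (z⁻¹ * v)|) ^ m
      ≤ z ^ (-α) * (1 + Real.log z) ^ m * (v ^ α * (1 + |Real.log v|) ^ m) := by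
    intro v hv
    have h1 : 1 + |Real.log (z⁻¹ * v)| ≤ (1 + Real.log z) * (1 + |Real.log v|) := by
      rw [Real.log_mul hzi.ne' hv.ne', Real.log_inv]
      have := abs_add_le (-Real.log z) (Real.log v)
      rw [abs_neg, abs_of_nonneg hlz] at this
      nlinarith [abs_nonneg (Real.log v), mul_nonneg hlz (abs_nonneg (Real.log v))]
    rw [Real.mul_rpow hzi.le hv.le, Real.inv_rpow hz0.le, ← Real.rpow_neg hz0.le]
    calc z ^ (-α) * v ^ α * (1 + |Real.log (z⁻¹ * v)|) ^ m
        ≤ z ^ (-α) * v ^ α * ((1 + Real.log z) * (1 + |Real.log v|)) ^ m := by gcongr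
      _ = _ := by rw [mul_pow]; ring
  set A : ℝ := C * L * (z ^ (-α) * (1 + Real.log z) ^ m) with hA
  have small : ∀ {G : ℝ → ℝ}, (∀ u, 0 < u → |G u| ≤ C * (u ^ α * (1 + |Real.log u|) ^ m)) →
      ∀ v, 0 < v → v ≤ 1 → |G (z⁻¹ * v)| ≤ A * v ^ (a - ε) := by
    intro G hG v hv hv1
    refine (hG _ (mul_pos hzi hv)).trans ?_
    have h2 : v ^ α * (1 + |Real.log v|) ^ m ≤ v ^ a * (L * v ^ (-ε)) := by
      gcongr ?_ * ?_
      · exact Real.rpow_le_rpow_of_exponent_ge hv hv1 hα.1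
      · exact hL2 v hv hv1
    have h3 : v ^ a * (L * v ^ (-ε)) = L * v ^ (a - ε) := by
      rw [sub_eq_add_neg, Real.rpow_add hv]; ring
    rw [h3] at h2
    calc C * ((z⁻¹ * v) ^ α * (1 + |Real.log (z⁻¹ * v)|) ^ m)
        ≤ C * (z ^ (-α) * (1 + Real.log z) ^ m * (L * v ^ (a - ε))) := by
          refine mul_le_mul_of_nonneg_left ((logb v hv).trans ?_) hC.le
          exact mul_le_mul_of_nonneg_left h2 (by positivity)
      _ = _ := by rw [hA]; ring
  have large : ∀ {G : ℝ → ℝ}, (∀ u, 0 < u → |G u| ≤ C * (u ^ α * (1 + |Real.log u|) ^ m)) →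
      ∀ v, 1 ≤ v → |G (z⁻¹ * v)| ≤ A * v ^ (b + ε) := by
    intro G hG v hv1
    have hv : 0 < v := by linarith
    refine (hG _ (mul_pos hzi hv)).trans ?_
    have h2 : v ^ α * (1 + |Real.log v|) ^ m ≤ v ^ b * (L * v ^ ε) := by
      gcongr ?_ * ?_
      · exact Real.rpow_le_rpow_of_exponent_le hv1 hα.2
      · exact hL1 v hv1
    have h3 : v ^ b * (L * v ^ ε) = L * v ^ (b + ε) := by
      rw [Real.rpow_add hv]; ring
    rw [h3] at h2
    calc C * ((z⁻¹ * v) ^ α * (1 + |Real.log (z⁻¹ * v)|) ^ m)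
        ≤ C * (z ^ (-α) * (1 + Real.log z) ^ m * (L * v ^ (b + ε))) := by
          refine mul_le_mul_of_nonneg_left ((logb v hv).trans ?_) hC.le
          exact mul_le_mul_of_nonneg_left h2 (by positivity)
      _ = _ := by rw [hA]; ring
  have dscale : ∀ {G G' : ℝ → ℝ}, (∀ u, 0 < u → HasDerivAt G (G' u / u) u) →
      ∀ v, 0 < v → HasDerivAt (fun v => G (z⁻¹ * v)) (G' (z⁻¹ * v) / v) v := by
    intro G G' h v hv
    have h1 : HasDerivAt (fun v => z⁻¹ * v) z⁻¹ v := by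
      simpa using (hasDerivAt_id v).const_mul z⁻¹
    refine HasDerivAt.congr_deriv ((h _ (mul_pos hzi hv)).comp v h1) ?_
    field_simp
  have dmscale : ∀ v, 0 < v → dm (z⁻¹ * v) ≤ z ^ (4:ℝ) * dm v := by
    intro v hv
    unfold dm
    rw [Real.mul_rpow hzi.le hv.le, Real.mul_rpow hzi.le hv.le, Real.inv_rpow hz0.le,
      Real.inv_rpow hz0.le, ← Real.rpow_neg hz0.le, ← Real.rpow_neg hz0.le, neg_neg, neg_neg,
      mul_min_of_nonneg _ _ (by positivity)]
    refine min_le_min ?_ le_rfl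
    gcongr
    norm_num
  have bscale : ∀ {G : ℝ → ℝ}, (∀ u, 0 < u → |G u| ≤ C * dm u) →
      ∀ v, 0 < v → |G (z⁻¹ * v)| ≤ C * z ^ (4:ℝ) * dm v := by
    intro G h v hv
    refine (h _ (mul_pos hzi hv)).trans ?_
    rw [mul_assoc]
    exact mul_le_mul_of_nonneg_left (dmscale v hv) hC.le
  have main := osc_bound hp hs (dscale hd0) (dscale hd1) (dscale hd2)
    (hc3.comp (by fun_prop) fun v hv => mul_pos hzi hv)
    (bscale hb0) (bscale hb1) (bscale hb2) (small hg1) (large hg1) (large hg2) (large hg3)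
  have hT : Tf G0 z = z⁻¹ * ∫ v in Ioi (0:ℝ), Real.cos v * G0 (z⁻¹ * v) := by
    have := integral_comp_mul_left_Ioi (fun v => Real.cos v * G0 (z⁻¹ * v)) 0 hz0
    simp only [mul_zero, smul_eq_mul] at this
    rw [← this]
    unfold Tf
    congr 1; ext u
    rw [← mul_assoc z⁻¹, inv_mul_cancel₀ hz0.ne', one_mul]
  rw [hT, abs_mul, abs_of_pos hzi]
  calc z⁻¹ * |∫ v in Ioi (0:ℝ), Real.cos v * G0 (z⁻¹ * v)|
      ≤ z⁻¹ * (A * (1 / (a - ε) + 3 + 6 / (2 - (b + ε)))) := by gcongr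
    _ = _ := by
      rw [hA, neg_add, Real.rpow_add hz0, Real.rpow_neg_one]; ring


/-! ### Part 4: vanishing integrals, and bounds for derivatives of the stable densities -/

lemma integrable_abs_of_Ioi {f : ℝ → ℝ} (hf : IntegrableOn f (Ioi 0)) :
    Integrable (fun x => f |x|) := by
  have hf' : IntegrableOn (fun x => f |x|) (Ioi 0) :=
    hf.congr_fun (fun x hx => by rw [abs_of_pos hx]) measurableSet_Ioi
  have int_Iic : IntegrableOn (fun x ↦ f |x|) (Iic 0) := by
    rw [← Measure.map_neg_eq_self (volume : Measure ℝ)]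
    let m : MeasurableEmbedding fun x : ℝ => -x := (Homeomorph.neg ℝ).measurableEmbedding
    rw [m.integrableOn_map_iff]
    simp_rw [Function.comp_def, abs_neg, neg_preimage, neg_Iic, neg_zero]
    exact Iff.mpr integrableOn_Ici_iff_integrableOn_Ioi hf'
  rw [← integrableOn_univ, ← Iic_union_Ioi (a := (0:ℝ))]
  exact int_Iic.union hf'

lemma Tf_eq_integral (G : ℝ → ℝ) (z : ℝ) :
    2 * Tf G z = ∫ u : ℝ, Real.cos (z * u) * G |u| := by
  unfold Tf
  rw [← integral_comp_abs (f := fun u => Real.cos (z * u) * G u)]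
  congr 1; ext u
  rcases abs_choice u with h | h
  · rw [h]
  · rw [h, mul_neg, Real.cos_neg]

open FourierTransform in
lemma Tf_integral_zero {G : ℝ → ℝ} (hi : IntegrableOn G (Ioi 0))
    (h0 : Tendsto G (𝓝[>] 0) (𝓝 0)) (hT : Integrable (Tf G)) : ∫ z, Tf G z = 0 := by
  have hiabs := integrable_abs_of_Ioi hi
  set h : ℝ → ℂ := fun u => if u = 0 then 0 else (G |u| : ℂ) with hh
  have hae : (fun u => (G |u| : ℂ)) =ᵐ[volume] h := by
    have : ∀ᵐ u : ℝ, u ≠ 0 := by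
      rw [ae_iff]; simp
    filter_upwards [this] with u hu
    simp [hh, hu]
  have hInt0 : Integrable h := (hiabs.ofReal (𝕜 := ℂ)).congr hae
  have hcont : ContinuousAt h 0 := by
    have e0 : h 0 = 0 := by simp [hh]
    rw [ContinuousAt, e0]
    rw [← nhdsNE_sup_pure, tendsto_sup]
    constructor
    · have ht : Tendsto (fun u : ℝ => |u|) (𝓝[≠] 0) (𝓝[>] 0) := by
        exact (tendsto_norm_nhdsNE_zero : Tendsto (norm : ℝ → ℝ) (𝓝[≠] 0) (𝓝[>] 0))
      have h2 := (Complex.continuous_ofReal.tendsto 0).comp (h0.comp ht)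
      simp only [Complex.ofReal_zero] at h2
      refine h2.congr' ?_
      filter_upwards [self_mem_nhdsWithin] with u hu
      have : u ≠ 0 := hu
      simp [hh, this]
    · rw [tendsto_pure_left]
      intro s hs
      rw [e0]; exact mem_of_mem_nhds hs
  have hF : ∀ ξ : ℝ, 𝓕 h ξ = ((2 * Tf G (2 * Real.pi * ξ) : ℝ) : ℂ) := by
    intro ξ
    rw [Real.fourier_real_eq_integral_exp_smul]
    set F : ℝ → ℂ := fun v => Complex.exp (((-2 * Real.pi * v * ξ : ℝ) : ℂ) * Complex.I) • h v with hFdef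
    have hFi : Integrable F := by
      refine Integrable.mono' hInt0.norm ?_ ?_
      · have hce : Continuous fun v : ℝ =>
            Complex.exp (((-2 * Real.pi * v * ξ : ℝ) : ℂ) * Complex.I) := by fun_prop
        exact hce.aestronglyMeasurable.smul hInt0.aestronglyMeasurable
      · refine Eventually.of_forall fun v => ?_
        rw [hFdef]
        simp only [norm_smul, Complex.norm_exp_ofReal_mul_I, one_mul, le_refl]
    have s1 : ∫ v, F v = ∫ v, F (-v) := (integral_neg_eq_self F volume).symm
    have s2 : 2 * ∫ v, F v = ∫ v, (F v + F (-v)) := by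
      rw [integral_add hFi hFi.comp_neg, ← s1]; ring
    have s3 : ∀ᵐ v : ℝ, F v + F (-v) = ((2 * (Real.cos (2 * Real.pi * ξ * v) * G |v|) : ℝ) : ℂ) := by
      filter_upwards [hae] with v hv
      have hneg : h (-v) = h v := by simp [hh]
      rw [hFdef]
      simp only [hneg, smul_eq_mul]
      rw [← hv, ← add_mul]
      have : Complex.exp (((-2 * Real.pi * v * ξ : ℝ) : ℂ) * Complex.I)
          + Complex.exp (((-2 * Real.pi * (-v) * ξ : ℝ) : ℂ) * Complex.I)
          = ((2 * Real.cos (2 * Real.pi * ξ * v) : ℝ) : ℂ) := by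
        push_cast
        rw [Complex.two_cos]
        rw [add_comm]
        congr 2 <;> ring
      rw [this]; push_cast; ring
    rw [integral_congr_ae s3, integral_complex_ofReal, integral_const_mul, ← Tf_eq_integral] at s2
    have : (2:ℂ) ≠ 0 := two_ne_zero
    apply mul_left_cancel₀ this
    rw [s2]; push_cast; ring
  have hpi : (2 * Real.pi) ≠ 0 := by positivity
  have hFint : Integrable (𝓕 h) := by
    have : 𝓕 h = fun ξ => ((2 * Tf G (2 * Real.pi * ξ) : ℝ) : ℂ) := funext hF
    rw [this]
    exact ((hT.comp_mul_left' hpi).const_mul 2).ofReal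
  have inv := hInt0.fourierInv_fourier_eq hFint hcont
  rw [Real.fourierInv_eq'] at inv
  simp only [inner_zero_right, mul_zero, Complex.ofReal_zero, zero_mul, Complex.exp_zero,
    one_smul] at inv
  have e0 : h 0 = 0 := by simp [hh]
  rw [e0] at inv
  simp_rw [hF] at inv
  rw [integral_complex_ofReal, Complex.ofReal_eq_zero, integral_const_mul,
    Measure.integral_comp_mul_left (fun z => Tf G z)] at inv
  simp only [smul_eq_mul, mul_eq_zero] at inv
  rcases inv with h | h | h
  · norm_num at h
  · have : |(2 * Real.pi)⁻¹| ≠ 0 := by positivity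
    exact absurd h this
  · exact h

/-- The weight `(1+|z|)^{-α-1} (1+ln(1+|z|))^m`. -/
def rho (m : ℕ) (α z : ℝ) : ℝ := (1 + |z|) ^ (-(α + 1)) * (1 + Real.log (1 + |z|)) ^ m

lemma one_add_log_pos (z : ℝ) : 1 ≤ 1 + Real.log (1 + |z|) := by
  have := Real.log_nonneg (by linarith [abs_nonneg z] : 1 ≤ 1 + |z|)
  linarith

lemma rho_pos (m : ℕ) (α z : ℝ) : 0 < rho m α z := by
  have := one_add_log_pos z
  have : 0 < 1 + |z| := by positivity
  unfold rho; positivity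

lemma rpow_one_add_le {α z : ℝ} (h0 : 0 < α) (h2 : α < 2) (hz : 1 ≤ z) :
    z ^ (-(α + 1)) ≤ 8 * (1 + z) ^ (-(α + 1)) := by
  have hz0 : 0 < z := by linarith
  have h1 : (1 + z) ^ (α + 1) ≤ 8 * z ^ (α + 1) := by
    calc (1 + z) ^ (α + 1) ≤ (2 * z) ^ (α + 1) := by gcongr; linarith
      _ = 2 ^ (α + 1) * z ^ (α + 1) := Real.mul_rpow (by norm_num) hz0.le
      _ ≤ 2 ^ (3:ℝ) * z ^ (α + 1) := by
        gcongr
        · norm_num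
        · linarith
      _ = _ := by norm_num
  rw [Real.rpow_neg hz0.le, Real.rpow_neg (by linarith), ← div_eq_mul_inv, inv_eq_one_div,
    div_le_div_iff₀ (by positivity) (by positivity)]
  linarith

lemma rho_ge_small {m : ℕ} {α z : ℝ} (h0 : 0 < α) (h2 : α < 2) (hz : |z| ≤ 1) :
    1 / 8 ≤ rho m α z := by
  have h1 : (1 / 8 : ℝ) ≤ (1 + |z|) ^ (-(α + 1)) := by
    have := rpow_one_add_le h0 h2 le_rfl
    rw [Real.one_rpow] at this
    have h3 : ((1:ℝ) + 1) ^ (-(α + 1)) ≤ (1 + |z|) ^ (-(α + 1)) :=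
      Real.rpow_le_rpow_of_nonpos (by positivity) (by linarith) (by linarith)
    linarith
  have h3 : 1 ≤ (1 + Real.log (1 + |z|)) ^ m := one_le_pow₀ (one_add_log_pos z)
  unfold rho
  nlinarith

/-- Families `G` that are dominated and whose logarithmic derivative lies in `GB m`. -/
def Tame (m : ℕ) (G : ℝ → ℝ → ℝ) : Prop :=
  (∀ a b : ℝ, 0 < a → ∃ C > (0:ℝ), ∀ α ∈ Icc a b, ∀ u : ℝ, 0 < u → |G α u| ≤ C * dm u) ∧
  ∃ G', GB m G' ∧ ∀ α u : ℝ, 0 < u → HasDerivAt (G α) (G' α u / u) u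

lemma GB.tame {m : ℕ} {G : ℝ → ℝ → ℝ} (h : GB m G) : Tame m G := by
  refine ⟨fun a b ha => ?_, h.theta⟩
  obtain ⟨C, hC, hb⟩ := h.bound a b ha
  exact ⟨C, hC, fun α hα u hu => (hb α hα u hu).1⟩

lemma tame_zero (c : ℝ) : Tame 0 (fun α u => c * Bf 0 0 α u) := by
  constructor
  · intro a b ha
    obtain ⟨C, hC, h⟩ := Bf_dm 0 0 a ha
    refine ⟨(|c| + 1) * C, by positivity, fun α hα u hu => ?_⟩
    have := h α hα.1 u hu
    have := dm_pos hu
    rw [abs_mul, mul_assoc]; gcongr; linarith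
  · refine ⟨_, .const c _ (.alpha _ (.base 0 1 le_rfl le_rfl)), fun α u hu => ?_⟩
    refine HasDerivAt.congr_deriv ((Bf_hasDerivAt 0 0 α u hu).const_mul c) ?_
    push_cast
    ring

lemma Tame.continuousOn {m : ℕ} {G : ℝ → ℝ → ℝ} (h : Tame m G) (α : ℝ) :
    ContinuousOn (G α) (Ioi 0) := by
  obtain ⟨-, G', -, hd⟩ := h
  exact fun u hu => (hd α u hu).continuousAt.continuousWithinAt

lemma Tame.bound {m : ℕ} {G : ℝ → ℝ → ℝ} (h : Tame m G) (a b : ℝ) (ha : 0 < a) (hb : b < 2) :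
    ∃ C > (0:ℝ), ∀ α ∈ Icc a b, ∀ z, |Tf (G α) z| ≤ C * rho m α z := by
  obtain ⟨hG0, G1, hG1, hd0⟩ := h
  obtain ⟨G2, hG2, hd1⟩ := hG1.theta
  obtain ⟨G3, hG3, hd2⟩ := hG2.theta
  obtain ⟨C0, hC0, hb0⟩ := hG0 a b ha
  obtain ⟨C1, hC1, hb1⟩ := hG1.bound a b ha
  obtain ⟨C2, hC2, hb2⟩ := hG2.bound a b ha
  obtain ⟨C3, hC3, hb3⟩ := hG3.bound a b ha
  set C := C0 + C1 + C2 + C3 with hCdef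
  have hC : 0 < C := by positivity
  obtain ⟨M, hM, hmain⟩ := tail_scaled a b ha hb m
  have up : ∀ {c x y : ℝ}, c ≤ C → 0 ≤ y → x ≤ c * y → x ≤ C * y := fun h1 h2 h3 =>
    h3.trans (mul_le_mul_of_nonneg_right h1 h2)
  have hI : 0 ≤ ∫ u in Ioi (0:ℝ), dm u :=
    setIntegral_nonneg measurableSet_Ioi fun u hu => (dm_pos hu).le
  refine ⟨8 * (C * M) + 8 * (C0 * ∫ u in Ioi (0:ℝ), dm u), by positivity, fun α hα => ?_⟩
  have hα0 : 0 < α := ha.trans_le hα.1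
  have hα2 : α < 2 := hα.2.trans_lt hb
  have large : ∀ z, 1 ≤ z → |Tf (G α) z| ≤ 8 * (C * M) * rho m α z := by
    intro z hz
    have key := hmain α hα (G α) (G1 α) (G2 α) (G3 α) C hC (hd0 α) (hd1 α) (hd2 α)
      (hG3.tame.continuousOn α)
      (fun u hu => up (by linarith) (dm_pos hu).le (hb0 α hα u hu))
      (fun u hu => up (by linarith) (dm_pos hu).le (hb1 α hα u hu).1)
      (fun u hu => up (by linarith) (dm_pos hu).le (hb2 α hα u hu).1)
      (fun u hu => up (by linarith) (by positivity) (hb1 α hα u hu).2)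
      (fun u hu => up (by linarith) (by positivity) (hb2 α hα u hu).2)
      (fun u hu => up (by linarith) (by positivity) (hb3 α hα u hu).2) z hz
    refine key.trans ?_
    have hz0 : 0 < z := by linarith
    unfold rho
    rw [abs_of_pos hz0]
    have h1 := rpow_one_add_le hα0 hα2 hz
    have hlz := Real.log_nonneg hz
    have h2 : (1 + Real.log z) ^ m ≤ (1 + Real.log (1 + z)) ^ m := by
      gcongr; linarith
    calc C * M * (z ^ (-(α + 1)) * (1 + Real.log z) ^ m)
        ≤ C * M * (8 * (1 + z) ^ (-(α + 1)) * (1 + Real.log (1 + z)) ^ m) := by gcongr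
      _ = _ := by ring
  have large' : ∀ z, 1 ≤ |z| → |Tf (G α) z| ≤ 8 * (C * M) * rho m α z := by
    intro z hz
    rcases abs_choice z with h | h
    · rw [h] at hz; exact large z hz
    · rw [h] at hz
      have := large _ hz
      rw [Tf_neg] at this
      simpa [rho] using this
  intro z
  have hr := rho_pos m α z
  rcases le_total 1 |z| with h | h
  · refine (large' z h).trans ?_
    have : 0 ≤ 8 * (C0 * ∫ u in Ioi (0:ℝ), dm u) * rho m α z := by positivity
    linarith
  · refine (Tf_bound (hb0 α hα) z).trans ?_
    have h8 := rho_ge_small (m := m) hα0 hα2 h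
    have e1 : 0 ≤ C0 * ∫ u in Ioi (0:ℝ), dm u := by positivity
    have e2 : 0 ≤ 8 * (C * M) * rho m α z := by positivity
    nlinarith

lemma rho_integrable (m : ℕ) {α : ℝ} (hα : 0 < α) : Integrable (rho m α) := by
  have hcont : Continuous (rho m α) := by
    unfold rho
    refine Continuous.mul ?_ ?_
    · exact Continuous.rpow_const (by fun_prop) fun z => Or.inl (by positivity)
    · refine Continuous.pow (continuous_const.add (Continuous.log (by fun_prop) fun z => ?_)) m
      positivity
  obtain ⟨C, hC, h⟩ := log_pow_le (α / 2) (by positivity) m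
  have hInt0 : Integrable (fun z : ℝ => C * (1 + ‖z‖) ^ (-(1 + α / 2))) :=
    (integrable_one_add_norm (by simp; exact hα)).const_mul C
  refine hInt0.mono' hcont.aestronglyMeasurable (Eventually.of_forall fun z => ?_)
  rw [Real.norm_eq_abs, abs_of_pos (rho_pos m α z), Real.norm_eq_abs]
  have hz : 1 ≤ 1 + |z| := by linarith [abs_nonneg z]
  have := h _ hz
  unfold rho
  calc (1 + |z|) ^ (-(α + 1)) * (1 + Real.log (1 + |z|)) ^ m
      ≤ (1 + |z|) ^ (-(α + 1)) * (C * (1 + |z|) ^ (α / 2)) := by gcongr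
    _ = C * ((1 + |z|) ^ (-(α + 1)) * (1 + |z|) ^ (α / 2)) := by ring
    _ = _ := by
      rw [← Real.rpow_add (by linarith)]; congr 2; ring

lemma Tame.continuous {m : ℕ} {G : ℝ → ℝ → ℝ} (h : Tame m G) {α : ℝ} (hα : 0 < α) :
    Continuous (Tf (G α)) := by
  obtain ⟨C, -, hb⟩ := h.1 α α hα
  exact continuous_iff_continuousAt.2 fun z =>
    (Tf_hasDerivAt (h.continuousOn α) (hb α ⟨le_rfl, le_rfl⟩) z).continuousAt

lemma Tame.integrable {m : ℕ} {G : ℝ → ℝ → ℝ} (h : Tame m G) {α : ℝ} (hα : α ∈ Ioo (0:ℝ) 2) :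
    Integrable (Tf (G α)) := by
  obtain ⟨C, -, hb⟩ := h.bound α α hα.1 hα.2
  exact ((rho_integrable m hα.1).const_mul C).mono' (h.continuous hα.1).aestronglyMeasurable
    (Eventually.of_forall fun z => hb α ⟨le_rfl, le_rfl⟩ z)

lemma GB.integral_zero {m : ℕ} {G : ℝ → ℝ → ℝ} (h : GB m G) {α : ℝ} (hα : α ∈ Ioo (0:ℝ) 2) :
    ∫ z, Tf (G α) z = 0 := by
  obtain ⟨C, hC, hb⟩ := h.bound α α hα.1
  have hb := hb α ⟨le_rfl, le_rfl⟩
  refine Tf_integral_zero (adm_int (h.tame.continuousOn α) fun u hu => (hb u hu).1) ?_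
    (h.tame.integrable hα)
  obtain ⟨L, hL, -, hl⟩ := log_pow_le' (α / 2) (by have := hα.1; positivity) m
  refine squeeze_zero_norm' (a := fun u => C * L * u ^ (α / 2)) ?_ ?_
  · filter_upwards [Ioo_mem_nhdsGT (zero_lt_one : (0:ℝ) < 1)] with u hu
    refine (hb u hu.1).2.trans ?_
    have hu0 := hu.1
    calc C * (u ^ α * (1 + |Real.log u|) ^ m) ≤ C * (u ^ α * (L * u ^ (-(α / 2)))) := by
          gcongr; exact hl u hu.1 hu.2.le
      _ = C * L * (u ^ α * u ^ (-(α / 2))) := by ring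
      _ = _ := by rw [← Real.rpow_add hu0]; congr 2; ring
  · have : ContinuousAt (fun u : ℝ => u ^ (α / 2)) 0 :=
      Real.continuousAt_rpow_const _ _ (Or.inr (by have := hα.1; positivity))
    have h2 := this.tendsto
    have hne : α / 2 ≠ 0 := by have := hα.1; positivity
    rw [Real.zero_rpow hne] at h2
    simpa using (h2.mono_left (nhdsWithin_le_nhds (s := Ioi (0:ℝ)))).const_mul (C * L)

lemma stableDensity_eq (α z : ℝ) : stableDensity α z = Real.pi⁻¹ * Tf (Bf 0 0 α) z := by
  unfold stableDensity
  have h := Tf_eq_integral (Bf 0 0 α) z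
  have e : ∀ u, Bf 0 0 α |u| = Real.exp (-(|u| ^ α)) := fun u => by simp [Bf, bq, Qp]
  simp_rw [e] at h
  rw [← h]
  have := Real.pi_pos
  field_simp

lemma iteratedDeriv_stable (m : ℕ) (z : ℝ) : ∀ α : ℝ, 0 < α →
    iteratedDeriv m (fun a => stableDensity a z) α = Real.pi⁻¹ * Tf (Bf m m α) z := by
  induction m with
  | zero => intro α _; simpa using stableDensity_eq α z
  | succ m ih =>
    intro α hα
    rw [iteratedDeriv_succ]
    have : iteratedDeriv m (fun a => stableDensity a z) =ᶠ[𝓝 α]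
        fun a => Real.pi⁻¹ * Tf (Bf m m a) z := by
      filter_upwards [Ioi_mem_nhds hα] with a ha using ih a ha
    rw [this.deriv_eq]
    exact ((Tf_alpha m m z α hα).const_mul _).deriv

lemma Tame.dop {m : ℕ} {G : ℝ → ℝ → ℝ} (h : Tame m G) :
    ∃ G', GB m G' ∧ ∀ α, 0 < α → ∀ z, Dop (Tf (G α)) z = Tf (G' α) z := by
  obtain ⟨h0, G', hG', hd⟩ := h
  refine ⟨_, .const (-1) _ hG', fun α hα z => ?_⟩
  obtain ⟨C, hC, hb⟩ := h0 α α hα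
  obtain ⟨C', hC', hb'⟩ := hG'.bound α α hα
  have hm : α ∈ Icc α α := ⟨le_rfl, le_rfl⟩
  rw [Tf_Dop (C := C + C') (hd α) (fun u hu => ?_) (hG'.tame.continuousOn α) (fun u hu => ?_),
    Tf_const_mul]
  · ring
  · have := hb α hm u hu
    have := dm_pos hu
    nlinarith
  · have := (hb' α hm u hu).1
    have := dm_pos hu
    nlinarith

lemma dop_family (l m : ℕ) : ∃ G, Tame m G ∧ (0 < l + m → GB m G) ∧
    ∀ α, 0 < α → Dop^[l] (fun z' => iteratedDeriv m (fun a => stableDensity a z') α) = Tf (G α) := by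
  induction l with
  | zero =>
    refine ⟨fun α u => Real.pi⁻¹ * Bf m m α u, ?_, ?_, ?_⟩
    · rcases Nat.eq_zero_or_pos m with rfl | hm
      · exact tame_zero _
      · exact (GB.const _ _ (.base m m le_rfl hm)).tame
    · intro hm
      exact .const _ _ (.base m m le_rfl (by omega))
    · intro α hα
      ext z
      simp only [Function.iterate_zero, id]
      rw [iteratedDeriv_stable m z α hα, Tf_const_mul]
  | succ l ih =>
    obtain ⟨G, hG, -, he⟩ := ih
    obtain ⟨G', hG', hd⟩ := hG.dop
    refine ⟨G', hG'.tame, fun _ => hG', fun α hα => ?_⟩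
    rw [Function.iterate_succ_apply', he α hα]
    ext z
    exact hd α hα z


/-! ### Part 5: Gaussian estimates -/

lemma gauss_hasDerivAt (x : ℝ) : HasDerivAt gauss (-x * gauss x) x := by
  unfold gauss
  have h1 : HasDerivAt (fun y : ℝ => -(y ^ 2) / 2) (-x) x := by
    refine HasDerivAt.congr_deriv ((hasDerivAt_pow 2 x).neg.div_const 2) ?_
    push_cast; ring
  refine HasDerivAt.congr_deriv (h1.exp.const_mul _) ?_
  ring

lemma gauss_pos (x : ℝ) : 0 < gauss x := by
  unfold gauss; positivity

lemma gauss_le (x : ℝ) : gauss x ≤ Real.exp (-(x ^ 2) / 2) := by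
  unfold gauss
  refine mul_le_of_le_one_left (Real.exp_pos _).le ?_
  apply inv_le_one_of_one_le₀
  rw [Real.one_le_sqrt]
  linarith [Real.pi_gt_three]

lemma pg_hasDerivAt (P : Polynomial ℝ) (x : ℝ) :
    HasDerivAt (fun x => P.eval x * gauss x)
      ((P.derivative - Polynomial.X * P).eval x * gauss x) x := by
  refine HasDerivAt.congr_deriv ((P.hasDerivAt x).mul (gauss_hasDerivAt x)) ?_
  simp; ring

lemma dop_gauss (k : ℕ) : ∃ P : Polynomial ℝ, P.natDegree ≤ 2 * k ∧
    Dop^[k] gauss = fun x => P.eval x * gauss x := by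
  induction k with
  | zero => exact ⟨1, by simp, by ext; simp⟩
  | succ k ih =>
    obtain ⟨P, hP, he⟩ := ih
    refine ⟨P + Polynomial.X * (P.derivative - Polynomial.X * P), ?_, ?_⟩
    · have h1 := Polynomial.natDegree_derivative_le P
      have h2 : (Polynomial.X * P).natDegree ≤ 1 + P.natDegree :=
        Polynomial.natDegree_mul_le.trans (by simp)
      have h3 := Polynomial.natDegree_sub_le P.derivative (Polynomial.X * P)
      have h4 : (Polynomial.X * (P.derivative - Polynomial.X * P)).natDegree
          ≤ 1 + (P.derivative - Polynomial.X * P).natDegree :=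
        Polynomial.natDegree_mul_le.trans (by simp)
      have h5 := Polynomial.natDegree_add_le P (Polynomial.X * (P.derivative - Polynomial.X * P))
      omega
    · rw [Function.iterate_succ_apply', he]
      ext x
      unfold Dop
      rw [(pg_hasDerivAt P x).deriv]
      simp; ring

lemma pow_exp_bound (n : ℕ) {c : ℝ} (x : ℝ) (hc : 0 < c) :
    (1 + |x|) ^ n ≤ n.factorial * Real.exp (1 + 1 / (4 * c)) * Real.exp (c * x ^ 2) := by
  refine (pow_le_fact_exp n (by positivity)).trans ?_
  rw [mul_assoc, ← Real.exp_add]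
  refine mul_le_mul_of_nonneg_left (Real.exp_le_exp.2 ?_) (by positivity)
  have h : |x| ≤ 1 / (4 * c) + c * |x| ^ 2 := by
    have : 1 / (4 * c) + c * |x| ^ 2 - |x| = (2 * c * |x| - 1) ^ 2 / (4 * c) := by
      field_simp; ring
    have h2 : 0 ≤ (2 * c * |x| - 1) ^ 2 / (4 * c) := by positivity
    linarith
  rw [sq_abs] at h
  linarith

lemma pg_bound (P : Polynomial ℝ) :
    ∃ C > (0:ℝ), ∀ x, |P.eval x * gauss x| ≤ C * Real.exp (-(x ^ 2) / 4) := by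
  obtain ⟨C, hC, h⟩ := poly_bound P
  set n := P.natDegree
  refine ⟨C * (n.factorial * Real.exp (1 + 1 / (4 * (1/4)))), by positivity, fun x => ?_⟩
  rw [abs_mul, abs_of_pos (gauss_pos x)]
  have h1 := pow_exp_bound n x (by norm_num : (0:ℝ) < 1/4)
  calc |P.eval x| * gauss x ≤ (C * (n.factorial * Real.exp (1 + 1 / (4 * (1/4)))
          * Real.exp (1/4 * x ^ 2))) * Real.exp (-(x ^ 2) / 2) :=
        mul_le_mul ((h x).trans (mul_le_mul_of_nonneg_left h1 hC.le)) (gauss_le x)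
          (gauss_pos x).le (by positivity)
    _ = C * (n.factorial * Real.exp (1 + 1 / (4 * (1/4)))) *
        (Real.exp (1/4 * x ^ 2) * Real.exp (-(x ^ 2) / 2)) := by ring
    _ = _ := by rw [← Real.exp_add]; congr 2; ring

lemma rho_ge (m : ℕ) {α : ℝ} (h2 : α < 2) (y : ℝ) : ((1 + |y|) ^ 3)⁻¹ ≤ rho m α y := by
  have hy : 1 ≤ 1 + |y| := by linarith [abs_nonneg y]
  have e : ((1 + |y|) ^ 3)⁻¹ = (1 + |y|) ^ (-(3:ℝ)) := by
    rw [Real.rpow_neg (by linarith)]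
    congr 1
    exact_mod_cast (Real.rpow_natCast (1 + |y|) 3).symm
  rw [e]
  unfold rho
  have h1 : (1 + |y|) ^ (-(3:ℝ)) ≤ (1 + |y|) ^ (-(α + 1)) :=
    Real.rpow_le_rpow_of_exponent_le hy (by linarith)
  have h3 : 1 ≤ (1 + Real.log (1 + |y|)) ^ m := one_le_pow₀ (one_add_log_pos y)
  refine h1.trans (le_mul_of_one_le_right (by positivity) h3)

lemma exp_le_rho (m : ℕ) : ∃ C > (0:ℝ), ∀ α < 2, ∀ y, Real.exp (-(y ^ 2) / 8) ≤ C * rho m α y := by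
  refine ⟨Nat.factorial 3 * Real.exp (1 + 1 / (4 * (1/8))), by positivity, fun α h2 y => ?_⟩
  refine le_trans ?_ (mul_le_mul_of_nonneg_left (rho_ge m h2 y) (by positivity))
  have h := pow_exp_bound 3 y (by norm_num : (0:ℝ) < 1/8)
  have hy : 0 < (1 + |y|) ^ 3 := by positivity
  rw [← div_eq_mul_inv, le_div_iff₀ hy]
  calc Real.exp (-(y ^ 2) / 8) * (1 + |y|) ^ 3
      ≤ Real.exp (-(y ^ 2) / 8) * (Nat.factorial 3 * Real.exp (1 + 1 / (4 * (1/8)))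
          * Real.exp (1/8 * y ^ 2)) := by gcongr
    _ = Nat.factorial 3 * Real.exp (1 + 1 / (4 * (1/8))) *
        (Real.exp (-(y ^ 2) / 8) * Real.exp (1/8 * y ^ 2)) := by ring
    _ = _ := by
      rw [← Real.exp_add]
      have : -(y ^ 2) / 8 + 1/8 * y ^ 2 = 0 := by ring
      rw [this, Real.exp_zero, mul_one]

lemma rho_peetre (m : ℕ) {α : ℝ} (h0 : 0 < α) (h2 : α < 2) (y s : ℝ) :
    rho m α s ≤ (1 + |y - s|) ^ (3 + m) * rho m α y := by
  have hs : 1 ≤ 1 + |s| := by linarith [abs_nonneg s]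
  have hy : 1 ≤ 1 + |y| := by linarith [abs_nonneg y]
  have hx : 1 ≤ 1 + |y - s| := by linarith [abs_nonneg (y - s)]
  have e1 : 1 + |y| ≤ (1 + |s|) * (1 + |y - s|) := by
    have := abs_add_le s (y - s)
    rw [add_sub_cancel] at this
    nlinarith [abs_nonneg s, abs_nonneg (y - s), mul_nonneg (abs_nonneg s) (abs_nonneg (y - s))]
  have e2 : 1 + |s| ≤ (1 + |y|) * (1 + |y - s|) := by
    have := abs_add_le y (s - y)
    rw [add_sub_cancel, abs_sub_comm s y] at this
    nlinarith [abs_nonneg y, abs_nonneg (y - s), mul_nonneg (abs_nonneg y) (abs_nonneg (y - s))]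
  have f1 : (1 + |s|) ^ (-(α + 1)) ≤ (1 + |y - s|) ^ 3 * (1 + |y|) ^ (-(α + 1)) := by
    have g1 : (1 + |y|) ^ (α + 1) ≤ (1 + |s|) ^ (α + 1) * (1 + |y - s|) ^ 3 := by
      calc (1 + |y|) ^ (α + 1) ≤ ((1 + |s|) * (1 + |y - s|)) ^ (α + 1) := by gcongr
        _ = (1 + |s|) ^ (α + 1) * (1 + |y - s|) ^ (α + 1) :=
          Real.mul_rpow (by linarith) (by linarith)
        _ ≤ (1 + |s|) ^ (α + 1) * (1 + |y - s|) ^ (3:ℝ) := by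
          gcongr
          linarith
        _ = _ := by congr 1; exact_mod_cast Real.rpow_natCast _ 3
    rw [Real.rpow_neg (by linarith), Real.rpow_neg (by linarith), ← div_eq_mul_inv, inv_eq_one_div,
      div_le_div_iff₀ (by positivity) (by positivity)]
    linarith
  have f2 : 1 + Real.log (1 + |s|) ≤ (1 + |y - s|) * (1 + Real.log (1 + |y|)) := by
    have l1 := Real.log_le_log (by linarith) e2
    rw [Real.log_mul (by linarith) (by linarith)] at l1
    have l2 := Real.log_le_sub_one_of_pos (by linarith : 0 < 1 + |y - s|)
    have l3 := Real.log_nonneg hy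
    nlinarith [abs_nonneg (y - s), mul_nonneg (abs_nonneg (y - s)) l3]
  have := one_add_log_pos s
  unfold rho
  calc _ ≤ ((1 + |y - s|) ^ 3 * (1 + |y|) ^ (-(α + 1))) *
        ((1 + |y - s|) * (1 + Real.log (1 + |y|))) ^ m := by gcongr
    _ = _ := by rw [mul_pow, pow_add]; ring

lemma one_le_log_three : 1 ≤ Real.log 3 := by
  rw [Real.le_log_iff_exp_le (by norm_num)]
  linarith [Real.exp_one_lt_d9]

lemma one_le_log_inv {w : ℝ} (hw : w ∈ Ioc (0:ℝ) (1/3)) : 1 ≤ Real.log (1 / w) := by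
  refine one_le_log_three.trans (Real.log_le_log (by norm_num) ?_)
  rw [le_div_iff₀ hw.1]; linarith [hw.2]

lemma rho_scale (m : ℕ) {α w z : ℝ} (h0 : 0 < α) (hw : w ∈ Ioc (0:ℝ) (1/3)) (hz : z ≠ 0) :
    rho m α z ≤ 2 ^ m * Real.log (1 / w) ^ m * (w * w ^ α) *
      (|w * z| ^ (-(α + 1)) * (1 + Real.log (1 + |w * z|)) ^ m) := by
  have hw0 := hw.1
  have hL := one_le_log_inv hw
  have hzp : 0 < |z| := abs_pos.2 hz
  have e1 : (1 + |z|) ^ (-(α + 1)) ≤ (w * w ^ α) * |w * z| ^ (-(α + 1)) := by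
    rw [abs_mul, abs_of_pos hw0, Real.mul_rpow hw0.le hzp.le, Real.rpow_neg hw0.le,
      Real.rpow_add_one hw0.ne']
    have : w * w ^ α * ((w ^ α * w)⁻¹ * |z| ^ (-(α + 1))) = |z| ^ (-(α + 1)) := by
      field_simp
    rw [this]
    exact Real.rpow_le_rpow_of_nonpos hzp (by linarith) (by linarith)
  have e2 : 1 + Real.log (1 + |z|) ≤ 2 * Real.log (1 / w) * (1 + Real.log (1 + |w * z|)) := by
    have h1 : 1 + |z| ≤ (1 / w) * (1 + |w * z|) := by
      rw [abs_mul, abs_of_pos hw0]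
      have : (1 / w) * (1 + w * |z|) = 1 / w + |z| := by field_simp
      rw [this]
      have : 1 ≤ 1 / w := by rw [le_div_iff₀ hw0]; linarith [hw.2]
      linarith
    have h2 := Real.log_le_log (by positivity) h1
    rw [Real.log_mul (by positivity) (by positivity)] at h2
    have h3 := one_add_log_pos (w * z)
    nlinarith
  have := one_add_log_pos z
  unfold rho
  calc _ ≤ ((w * w ^ α) * |w * z| ^ (-(α + 1))) *
        (2 * Real.log (1 / w) * (1 + Real.log (1 + |w * z|))) ^ m := by gcongr
    _ = _ := by rw [mul_pow, mul_pow]; ring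

lemma rho_le_psi (m : ℕ) (K : Set ℝ) (hK : IsCompact K) (hKsub : K ⊆ Set.Ioo (0 : ℝ) 2)
    (ψ : ℝ → ℕ → ℝ → ℝ) (hψ : IsPsiFamily ψ) :
    ∃ C > (0:ℝ), ∀ α ∈ K, ∀ y, rho m α y ≤ C * ψ α m y := by
  obtain ⟨c, hc, _, hcb⟩ := hψ.unifBound K hKsub hK m
  refine ⟨4 ^ m + 4 ^ m / c, by positivity, fun α hα y => ?_⟩
  have hα' := hKsub hα
  have hpos := hψ.pos α hα' m y
  have hy : 1 ≤ 1 + |y| := by linarith [abs_nonneg y]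
  have h1y := one_add_log_pos y
  have r1 : (1 + |y|) ^ (-(α + 1)) ≤ 1 :=
    Real.rpow_le_one_of_one_le_of_nonpos hy (by linarith [hα'.1])
  have small : |y| ≤ 3 → rho m α y ≤ 4 ^ m := by
    intro h3
    have : 1 + Real.log (1 + |y|) ≤ 4 := by
      have := Real.log_le_sub_one_of_pos (by linarith : 0 < 1 + |y|); linarith
    unfold rho
    calc _ ≤ 1 * (4:ℝ) ^ m := by gcongr
      _ = _ := one_mul _
  have p4 : (0:ℝ) < 4 ^ m := by positivity
  have p5 : (0:ℝ) < 4 ^ m / c := by positivity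
  rcases le_total |y| 1 with h | h
  · rw [hψ.eq_one α hα' m y h]
    have := small (by linarith)
    linarith
  rcases le_total |y| 3 with h3 | h3
  · have h5 := (hcb α hα y h h3).1
    have h6 := small h3
    have h7 : (4:ℝ) ^ m ≤ 4 ^ m / c * ψ α m y := by
      rw [div_mul_eq_mul_div, le_div_iff₀ hc]
      exact mul_le_mul_of_nonneg_left h5 p4.le
    nlinarith
  · have hy0 : 0 < |y| := by linarith
    have hl : 1 ≤ Real.log |y| := one_le_log_three.trans (Real.log_le_log (by norm_num) h3)
    have key : rho m α y ≤ 4 ^ m * ψ α m y := by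
      rw [hψ.eq_tail α hα' m y h3]
      have e1 : (1 + |y|) ^ (-(α + 1)) ≤ |y| ^ (-(α + 1)) :=
        Real.rpow_le_rpow_of_nonpos hy0 (by linarith) (by linarith [hα'.1])
      have e2 : 1 + Real.log (1 + |y|) ≤ 4 * Real.log |y| := by
        have h5 : Real.log (1 + |y|) ≤ Real.log (2 * |y|) :=
          Real.log_le_log (by linarith) (by linarith)
        rw [Real.log_mul (by norm_num) hy0.ne'] at h5
        have := Real.log_le_sub_one_of_pos (by norm_num : (0:ℝ) < 2)
        linarith
      unfold rho
      calc _ ≤ |y| ^ (-(α + 1)) * (4 * Real.log |y|) ^ m := by gcongr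
        _ = _ := by rw [mul_pow, Real.rpow_neg hy0.le]; ring
    nlinarith

lemma poly_gauss_le (P : Polynomial ℝ) (k : ℕ) (hP : P.natDegree ≤ 2 * k) :
    ∃ C > (0:ℝ), ∀ α < 2, ∀ w ∈ Ioc (0:ℝ) (1/3), ∀ y, |P.eval y * gauss y| ≤
      C * Real.log (1 / w) ^ k * (gauss y + w ^ α * rho 0 α y) := by
  obtain ⟨C1, hC1, h1⟩ := poly_bound P
  obtain ⟨C2, hC2, h2⟩ := pg_bound P
  obtain ⟨C3, hC3, h3⟩ := exp_le_rho 0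
  refine ⟨C1 * 32 ^ k + C2 * (Real.exp (1/8) * C3), by positivity, fun α hα w hw y => ?_⟩
  have hL := one_le_log_inv hw
  have hLk : 1 ≤ Real.log (1 / w) ^ k := one_le_pow₀ hL
  have hw0 := hw.1
  have hg := gauss_pos y
  have hr := rho_pos 0 α y
  have hwa : 0 < w ^ α := by positivity
  have hy : 1 ≤ 1 + |y| := by linarith [abs_nonneg y]
  rcases le_total ((1 + |y|) ^ 2) (32 * Real.log (1 / w)) with h | h
  · rw [abs_mul, abs_of_pos hg]
    have e : |P.eval y| ≤ C1 * 32 ^ k * Real.log (1 / w) ^ k := by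
      calc |P.eval y| ≤ C1 * (1 + |y|) ^ P.natDegree := h1 y
        _ ≤ C1 * (1 + |y|) ^ (2 * k) := by gcongr
        _ = C1 * ((1 + |y|) ^ 2) ^ k := by rw [pow_mul]
        _ ≤ C1 * (32 * Real.log (1 / w)) ^ k := by gcongr
        _ = _ := by rw [mul_pow]; ring
    calc |P.eval y| * gauss y ≤ C1 * 32 ^ k * Real.log (1 / w) ^ k * gauss y := by gcongr
      _ ≤ _ := by
        gcongr
        · linarith [show 0 < C2 * (Real.exp (1/8) * C3) by positivity]
        · linarith [mul_pos hwa hr]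
  · have e1 : Real.exp (-(y ^ 2) / 8) ≤ Real.exp (1/8) * w ^ α := by
      rw [Real.rpow_def_of_pos hw0, ← Real.exp_add]
      gcongr
      have hlw : Real.log (1 / w) = - Real.log w := by rw [one_div, Real.log_inv]
      rw [hlw] at h hL
      have : (1 + |y|) ^ 2 ≤ 2 + 2 * y ^ 2 := by
        have := sq_abs y
        nlinarith [sq_nonneg (1 - |y|)]
      nlinarith
    have e2 := h3 α hα y
    calc |P.eval y * gauss y| ≤ C2 * Real.exp (-(y ^ 2) / 4) := h2 y
      _ = C2 * (Real.exp (-(y ^ 2) / 8) * Real.exp (-(y ^ 2) / 8)) := by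
        rw [← Real.exp_add]; congr 2; ring
      _ ≤ C2 * ((Real.exp (1/8) * w ^ α) * (C3 * rho 0 α y)) := by gcongr
      _ = C2 * (Real.exp (1/8) * C3) * 1 * (w ^ α * rho 0 α y) := by ring
      _ ≤ _ := by
        gcongr
        · linarith [show 0 < C1 * 32 ^ k by positivity]
        · linarith


/-! ### Part 6: the convolution estimate -/

lemma taylor_two {f f1 f2 : ℝ → ℝ} (h1 : ∀ x, HasDerivAt f (f1 x) x)
    (h2 : ∀ x, HasDerivAt f1 (f2 x) x) {y M : ℝ} (hM : ∀ x, |x - y| ≤ 1 → |f2 x| ≤ M)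
    {s : ℝ} (hs : |s| ≤ 1) : |f (y - s) - f y + s * f1 y| ≤ M * s ^ 2 := by
  have hM0 : 0 ≤ M := (abs_nonneg _).trans (hM y (by simp))
  have hconv : Convex ℝ (Metric.closedBall y |s|) := convex_closedBall y |s|
  have hy : y ∈ Metric.closedBall y |s| := Metric.mem_closedBall_self (abs_nonneg s)
  have A : ∀ x ∈ Metric.closedBall y |s|, |f1 x - f1 y| ≤ M * |s| := by
    intro x hx
    have := hconv.norm_image_sub_le_of_norm_hasDerivWithin_le (f := f1) (f' := f2) (C := M)
      (fun x _ => (h2 x).hasDerivWithinAt)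
      (fun x hx => hM x (by
        rw [Metric.mem_closedBall, Real.dist_eq] at hx; linarith)) hy hx
    rw [Metric.mem_closedBall, Real.dist_eq] at hx
    simp only [Real.norm_eq_abs] at this
    exact this.trans (mul_le_mul_of_nonneg_left hx hM0)
  have hx : y - s ∈ Metric.closedBall y |s| := by
    rw [Metric.mem_closedBall, Real.dist_eq]
    simp
  have B := hconv.norm_image_sub_le_of_norm_hasDerivWithin_le
    (f := fun x => f x - x * f1 y) (f' := fun x => f1 x - 1 * f1 y) (C := M * |s|)
      (fun x _ => ((h1 x).sub ((hasDerivAt_id x).mul_const (f1 y))).hasDerivWithinAt)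
      (fun x hx => by rw [one_mul]; exact A x hx) hy hx
  simp only [Real.norm_eq_abs] at B
  have e : f (y - s) - f y + s * f1 y = f (y - s) - (y - s) * f1 y - (f y - y * f1 y) := by ring
  rw [e]
  refine B.trans (le_of_eq ?_)
  rw [show y - s - y = -s by ring, abs_neg, mul_assoc, ← abs_mul, ← sq, abs_of_nonneg (sq_nonneg s)]

/-- the Taylor remainder -/
def Rem (Φ Φ1 : ℝ → ℝ) (y s : ℝ) : ℝ := Φ (y - s) - Φ y + (if |s| ≤ 1 then s * Φ1 y else 0)

/-- dominating kernel -/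
def kap (a b : ℝ) (m : ℕ) (y s : ℝ) : ℝ :=
  (if |s| ≤ 1 then |s| ^ (1 - b) else 0) + rho m a s + Real.exp (-((y - s) ^ 2) / 8)

lemma rho_anti (m : ℕ) {a α : ℝ} (h : a ≤ α) (s : ℝ) : rho m α s ≤ rho m a s := by
  have hs : 1 ≤ 1 + |s| := by linarith [abs_nonneg s]
  have := one_add_log_pos s
  unfold rho
  refine mul_le_mul_of_nonneg_right ?_ (by positivity)
  exact Real.rpow_le_rpow_of_exponent_le hs (by linarith)

lemma kap1_integrable {b : ℝ} (hb : b < 2) :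
    Integrable (fun s : ℝ => if |s| ≤ 1 then |s| ^ (1 - b) else 0) := by
  apply integrable_abs_of_Ioi (f := fun u => if u ≤ 1 then u ^ (1 - b) else 0)
  have h := rpow_integrableOn_Ioc (r := 1 - b) (by linarith)
  rw [← integrable_indicator_iff measurableSet_Ioc] at h
  refine (h.integrableOn (s := Ioi 0)).congr_fun (fun u hu => ?_) measurableSet_Ioi
  by_cases h1 : u ≤ 1
  · simp [indicator, h1, mem_Ioi.1 hu]
  · simp [indicator, h1]

lemma exp8_integrable : Integrable (fun s : ℝ => Real.exp (-(s ^ 2) / 8)) := by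
  refine (integrable_exp_neg_mul_sq (by norm_num : (0:ℝ) < 1/8)).congr
    (Eventually.of_forall fun s => ?_)
  simp only; congr 1; ring

lemma kap_integrable {a b : ℝ} (m : ℕ) (ha : 0 < a) (hb : b < 2) (y : ℝ) :
    Integrable (kap a b m y) :=
  ((kap1_integrable hb).add (rho_integrable m ha)).add (exp8_integrable.comp_sub_left y)

lemma kap_integral {a b : ℝ} (m : ℕ) (ha : 0 < a) (hb : b < 2) (y : ℝ) :
    ∫ s, kap a b m y s = (∫ s : ℝ, if |s| ≤ 1 then |s| ^ (1 - b) else 0) + (∫ s, rho m a s)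
      + ∫ s : ℝ, Real.exp (-(s ^ 2) / 8) := by
  unfold kap
  have hi : Integrable (fun s : ℝ => (if |s| ≤ 1 then |s| ^ (1 - b) else 0) + rho m a s) :=
    (kap1_integrable hb).add (rho_integrable m ha)
  rw [integral_add hi (exp8_integrable.comp_sub_left y), integral_add (kap1_integrable hb) (rho_integrable m ha),
    integral_sub_left_eq_self (fun s => Real.exp (-(s ^ 2) / 8)) volume y]

lemma kap_parts (a b : ℝ) (m : ℕ) (y s : ℝ) :
    0 ≤ (if |s| ≤ 1 then |s| ^ (1 - b) else 0) ∧ 0 < rho m a s ∧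
      0 < Real.exp (-((y - s) ^ 2) / 8) := by
  refine ⟨?_, rho_pos _ _ _, Real.exp_pos _⟩
  split_ifs <;> positivity

lemma kap_nonneg (a b : ℝ) (m : ℕ) (y s : ℝ) : 0 ≤ kap a b m y s := by
  obtain ⟨h1, h2, h3⟩ := kap_parts a b m y s
  unfold kap; linarith

lemma rem_bound (m : ℕ) (P : Polynomial ℝ) (a b : ℝ) (ha : 0 < a) (hb : b < 2) :
    ∃ C > (0:ℝ), ∀ α ∈ Icc a b, ∀ y s, s ≠ 0 →
      |Rem (fun x => P.eval x * gauss x)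
        (fun x => (P.derivative - Polynomial.X * P).eval x * gauss x) y s| *
        (|s| ^ (-(α + 1)) * (1 + Real.log (1 + |s|)) ^ m) ≤ C * rho m α y * kap a b m y s := by
  set P1 := P.derivative - Polynomial.X * P with hP1
  set P2 := P1.derivative - Polynomial.X * P1 with hP2
  obtain ⟨C0, hC0, h0⟩ := pg_bound P
  obtain ⟨C2, hC2, h2⟩ := pg_bound P2
  obtain ⟨C3, hC3, h3⟩ := exp_le_rho m
  have d1 := pg_hasDerivAt P
  have d2 := pg_hasDerivAt P1
  rw [← hP1] at d1
  rw [← hP2] at d2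
  set D := ((3 + m).factorial : ℝ) * Real.exp (1 + 1 / (4 * (1/8))) with hD
  have hDp : 0 < D := by positivity
  set E1 := C2 * Real.exp (1/4) * C3 * 2 ^ m with hE1
  have hE1p : 0 < E1 := by positivity
  set E2 := 8 * C0 * C3 with hE2
  have hE2p : 0 < E2 := by positivity
  set E3 := 8 * C0 * D with hE3
  have hE3p : 0 < E3 := by positivity
  refine ⟨E1 + E2 + E3, by positivity, fun α hα y s hs => ?_⟩
  have hα0 : 0 < α := ha.trans_le hα.1
  have hα2 : α < 2 := hα.2.trans_lt hb
  have hs0 : 0 < |s| := abs_pos.2 hs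
  have hls := one_add_log_pos s
  have hr := rho_pos m α y
  obtain ⟨k1, k2, k3⟩ := kap_parts a b m y s
  rcases le_or_gt |s| 1 with h1 | h1
  · have T := taylor_two d1 d2 (y := y) (M := C2 * (Real.exp (1/4) * Real.exp (-(y ^ 2) / 8)))
      (fun x hx => (h2 x).trans (by
        refine mul_le_mul_of_nonneg_left ?_ hC2.le
        rw [← Real.exp_add]
        refine Real.exp_le_exp.2 ?_
        have hx2 : (x - y) ^ 2 ≤ 1 := by rw [← sq_abs]; nlinarith [abs_nonneg (x - y)]
        nlinarith [sq_nonneg (2 * x - y)])) h1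
    have eR : Rem (fun x => P.eval x * gauss x) (fun x => P1.eval x * gauss x) y s =
      P.eval (y - s) * gauss (y - s) - P.eval y * gauss y + s * (P1.eval y * gauss y) := by
      simp only [Rem, h1, if_true]
    rw [eR]
    have l2 : 1 + Real.log (1 + |s|) ≤ 2 := by
      have := Real.log_le_sub_one_of_pos (by linarith : 0 < 1 + |s|); linarith
    have ex : s ^ 2 * |s| ^ (-(α + 1)) ≤ |s| ^ (1 - b) := by
      rw [← sq_abs, ← Real.rpow_natCast, ← Real.rpow_add hs0]
      refine Real.rpow_le_rpow_of_exponent_ge hs0 h1 ?_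
      push_cast; linarith [hα.2]
    have hM : C2 * (Real.exp (1/4) * Real.exp (-(y ^ 2) / 8)) ≤
        C2 * Real.exp (1/4) * C3 * rho m α y := by
      have := mul_le_mul_of_nonneg_left (h3 α hα2 y) (by positivity : 0 ≤ C2 * Real.exp (1/4))
      linarith
    have hk : kap a b m y s = |s| ^ (1 - b) + rho m a s + Real.exp (-((y - s) ^ 2) / 8) := by
      simp [kap, h1]
    calc _ ≤ (C2 * Real.exp (1/4) * C3 * rho m α y * s ^ 2) * (|s| ^ (-(α + 1)) * 2 ^ m) :=
          mul_le_mul (T.trans (mul_le_mul_of_nonneg_right hM (sq_nonneg s)))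
            (mul_le_mul_of_nonneg_left (pow_le_pow_left₀ (by linarith) l2 m) (by positivity))
            (by positivity) (by positivity)
      _ = E1 * rho m α y * (s ^ 2 * |s| ^ (-(α + 1))) := by rw [hE1]; ring
      _ ≤ E1 * rho m α y * |s| ^ (1 - b) := mul_le_mul_of_nonneg_left ex (by positivity)
      _ ≤ (E1 + E2 + E3) * rho m α y * kap a b m y s := by
        refine mul_le_mul ?_ ?_ (by positivity) (by positivity)
        · exact mul_le_mul_of_nonneg_right (by linarith) hr.le
        · rw [hk]; linarith
  · have eR : Rem (fun x => P.eval x * gauss x) (fun x => P1.eval x * gauss x) y s =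
      P.eval (y - s) * gauss (y - s) - P.eval y * gauss y := by
      simp only [Rem, not_le.2 h1, if_false, add_zero]
    rw [eR]
    have hk : kap a b m y s = rho m a s + Real.exp (-((y - s) ^ 2) / 8) := by
      simp [kap, not_le.2 h1]
    have w1 : |s| ^ (-(α + 1)) * (1 + Real.log (1 + |s|)) ^ m ≤ 8 * rho m α s := by
      unfold rho
      rw [← mul_assoc]
      exact mul_le_mul_of_nonneg_right (rpow_one_add_le hα0 hα2 h1.le) (by positivity)
    have a1 : |P.eval y * gauss y| ≤ C0 * C3 * rho m α y := by
      refine (h0 y).trans ?_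
      rw [mul_assoc]
      refine mul_le_mul_of_nonneg_left (le_trans (Real.exp_le_exp.2 ?_) (h3 α hα2 y)) hC0.le
      nlinarith [sq_nonneg y]
    have a2 : |P.eval (y - s) * gauss (y - s)| * rho m α s ≤
        C0 * D * rho m α y * Real.exp (-((y - s) ^ 2) / 8) := by
      have q1 := pow_exp_bound (3 + m) (y - s) (by norm_num : (0:ℝ) < 1/8)
      rw [← hD] at q1
      calc _ ≤ (C0 * Real.exp (-((y - s) ^ 2) / 4)) *
            ((D * Real.exp (1/8 * (y - s) ^ 2)) * rho m α y) :=
            mul_le_mul (h0 _) ((rho_peetre m hα0 hα2 y s).trans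
              (mul_le_mul_of_nonneg_right q1 hr.le)) (rho_pos _ _ _).le (by positivity)
        _ = C0 * D * rho m α y * (Real.exp (-((y - s) ^ 2) / 4) *
            Real.exp (1/8 * (y - s) ^ 2)) := by ring
        _ = _ := by rw [← Real.exp_add]; congr 2; ring
    have a3 := rho_anti m hα.1 s
    have a4 := rho_pos m α s
    have a5 : |P.eval y * gauss y| * rho m α s ≤ C0 * C3 * rho m α y * rho m a s :=
      mul_le_mul a1 a3 a4.le (by positivity)
    have f1 : 0 ≤ rho m α y * rho m a s := by positivity
    have f2 : 0 ≤ rho m α y * Real.exp (-((y - s) ^ 2) / 8) := by positivity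
    calc _ ≤ (|P.eval (y - s) * gauss (y - s)| + |P.eval y * gauss y|) * (8 * rho m α s) :=
          mul_le_mul (abs_sub _ _) w1 (by positivity) (by positivity)
      _ ≤ E2 * (rho m α y * rho m a s) + E3 * (rho m α y * Real.exp (-((y - s) ^ 2) / 8)) := by
        rw [hE2, hE3]; linarith
      _ ≤ (E1 + E2 + E3) * (rho m α y * rho m a s) +
          (E1 + E2 + E3) * (rho m α y * Real.exp (-((y - s) ^ 2) / 8)) := by
        refine add_le_add (mul_le_mul_of_nonneg_right (by linarith) f1)
          (mul_le_mul_of_nonneg_right (by linarith) f2)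
      _ = _ := by rw [hk]; ring

lemma conv_bound (m : ℕ) (P : Polynomial ℝ) (a b : ℝ) (ha : 0 < a) (hb : b < 2) :
    ∃ C > (0:ℝ), ∀ α ∈ Icc a b, ∀ w ∈ Ioc (0:ℝ) (1/3), ∀ y, ∀ (g : ℝ → ℝ) (Cg : ℝ),
      Continuous g → (∀ z, g (-z) = g z) → (∀ z, |g z| ≤ Cg * rho m α z) →
      |(∫ z, (P.eval (y - w * z) * gauss (y - w * z)) * g z) -
        P.eval y * gauss y * ∫ z, g z| ≤
        Cg * C * Real.log (1 / w) ^ m * w ^ α * rho m α y := by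
  obtain ⟨C, hC, h⟩ := rem_bound m P a b ha hb
  obtain ⟨C0, hC0, h0⟩ := pg_bound P
  set J := (∫ s : ℝ, if |s| ≤ 1 then |s| ^ (1 - b) else 0) + (∫ s, rho m a s)
      + ∫ s : ℝ, Real.exp (-(s ^ 2) / 8) with hJ
  have hJ0 : 0 ≤ J := by
    rw [hJ, ← kap_integral m ha hb 0]
    exact integral_nonneg fun s => kap_nonneg _ _ _ _ _
  refine ⟨2 ^ m * C * (J + 1), by positivity, fun α hα w hw y g Cg gc ge gb => ?_⟩
  have hw0 := hw.1
  have hα0 : 0 < α := ha.trans_le hα.1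
  have hL := one_le_log_inv hw
  have hr := rho_pos m α y
  have hCg : 0 ≤ Cg := by
    have h1 := (abs_nonneg _).trans (gb 0)
    exact nonneg_of_mul_nonneg_left h1 (rho_pos _ _ _)
  have gi : Integrable g :=
    ((rho_integrable m hα0).const_mul Cg).mono' gc.aestronglyMeasurable
      (Eventually.of_forall fun z => gb z)
  set Φ : ℝ → ℝ := fun x => P.eval x * gauss x with hΦ
  set Φ1 : ℝ → ℝ := fun x => (P.derivative - Polynomial.X * P).eval x * gauss x with hΦ1
  have Φc : Continuous Φ := continuous_iff_continuousAt.2 fun x => (pg_hasDerivAt P x).continuousAt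
  have Φb : ∀ x, |Φ x| ≤ C0 := fun x => (h0 x).trans (by
    refine mul_le_of_le_one_right hC0.le (Real.exp_le_one_iff.2 ?_)
    nlinarith [sq_nonneg x])
  have i1 : Integrable (fun z => Φ (y - w * z) * g z) :=
    gi.bdd_mul (c := C0) (Φc.comp (by fun_prop)).aestronglyMeasurable
      (Eventually.of_forall fun z => Φb _)
  set F : ℝ → ℝ := fun z => (if |w * z| ≤ 1 then (w * z) * Φ1 y else 0) * g z with hF
  have i2 : Integrable F := by
    refine gi.bdd_mul (c := |Φ1 y|) ?_ (Eventually.of_forall fun z => ?_)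
    · refine Measurable.aestronglyMeasurable (Measurable.ite ?_ (by fun_prop) measurable_const)
      exact measurableSet_le (by fun_prop) measurable_const
    · rw [Real.norm_eq_abs]
      split_ifs with hz
      · rw [abs_mul]; exact mul_le_of_le_one_left (abs_nonneg _) hz
      · simp
  have F0 : ∫ z, F z = 0 := by
    have e1 : ∫ z, F (-z) = ∫ z, F z := integral_neg_eq_self F volume
    have e2 : ∫ z, F (-z) = -∫ z, F z := by
      rw [← integral_neg]
      congr 1; ext z
      simp only [hF, ge, mul_neg, abs_neg]
      split_ifs <;> ring
    linarith
  have eq : (∫ z, Φ (y - w * z) * g z) - Φ y * ∫ z, g z = ∫ z, Rem Φ Φ1 y (w * z) * g z := by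
    have : ∀ z, Rem Φ Φ1 y (w * z) * g z = Φ (y - w * z) * g z - Φ y * g z + F z := by
      intro z; simp only [Rem, hF]; ring
    simp only [this]
    have i3 : Integrable (fun z => Φ (y - w * z) * g z - Φ y * g z) := i1.sub (gi.const_mul _)
    rw [integral_add i3 i2, integral_sub i1 (gi.const_mul _), F0,
      integral_const_mul, add_zero]
  change |(∫ z, Φ (y - w * z) * g z) - Φ y * ∫ z, g z| ≤ _
  rw [eq]
  set B := Cg * (2 ^ m * Real.log (1 / w) ^ m * (w * w ^ α)) * (C * rho m α y) with hB
  have key : |∫ z, Rem Φ Φ1 y (w * z) * g z| ≤ ∫ z, B * kap a b m y (w * z) := by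
    rw [← Real.norm_eq_abs]
    refine norm_integral_le_of_norm_le
      (((kap_integrable m ha hb y).comp_mul_left' hw0.ne').const_mul B) ?_
    have hne : ∀ᵐ z : ℝ, z ≠ 0 := by simp [ae_iff]
    filter_upwards [hne] with z hz
    rw [Real.norm_eq_abs, abs_mul]
    have hwz : w * z ≠ 0 := mul_ne_zero hw0.ne' hz
    have r1 := h α hα y (w * z) hwz
    calc |Rem Φ Φ1 y (w * z)| * |g z| ≤ |Rem Φ Φ1 y (w * z)| *
          (Cg * (2 ^ m * Real.log (1 / w) ^ m * (w * w ^ α) *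
            (|w * z| ^ (-(α + 1)) * (1 + Real.log (1 + |w * z|)) ^ m))) :=
          mul_le_mul_of_nonneg_left ((gb z).trans
            (mul_le_mul_of_nonneg_left (rho_scale m hα0 hw hz) hCg)) (abs_nonneg _)
      _ = (Cg * (2 ^ m * Real.log (1 / w) ^ m * (w * w ^ α))) * (|Rem Φ Φ1 y (w * z)| *
            (|w * z| ^ (-(α + 1)) * (1 + Real.log (1 + |w * z|)) ^ m)) := by ring
      _ ≤ (Cg * (2 ^ m * Real.log (1 / w) ^ m * (w * w ^ α))) *
            (C * rho m α y * kap a b m y (w * z)) :=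
          mul_le_mul_of_nonneg_left r1 (by positivity)
      _ = _ := by rw [hB]; ring
  refine key.trans ?_
  rw [integral_const_mul, Measure.integral_comp_mul_left (fun s => kap a b m y s) w,
    kap_integral m ha hb y, ← hJ, abs_of_pos (inv_pos.2 hw0), smul_eq_mul]
  have e : B * (w⁻¹ * J) = Cg * (2 ^ m * C * J) * Real.log (1 / w) ^ m * w ^ α * rho m α y := by
    rw [hB]; field_simp
  rw [e]
  gcongr
  linarith


/-! ### Part 7: conclusion -/

lemma main_rho (a b : ℝ) (ha : 0 < a) (hb : b < 2) (k l m : ℕ) :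
    (∃ C > (0:ℝ), ∀ α ∈ Icc a b, ∀ w ∈ Ioc (0:ℝ) (1/3), ∀ y,
      |fklm α k 0 0 y w| ≤ C * Real.log (1 / w) ^ k * (gauss y + w ^ α * rho 0 α y)) ∧
    (∃ C > (0:ℝ), ∀ α ∈ Icc a b, ∀ w ∈ Ioc (0:ℝ) (1/3), ∀ y, 0 < l + m →
      |fklm α k l m y w| ≤ C * Real.log (1 / w) ^ m * w ^ α * rho m α y) := by
  obtain ⟨P, hP, hPe⟩ := dop_gauss k
  constructor
  · obtain ⟨G, hG, -, hGe⟩ := dop_family 0 0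
    obtain ⟨Cg, hCg, hb1⟩ := hG.bound a b ha hb
    obtain ⟨C, hC, hc⟩ := conv_bound 0 P a b ha hb
    obtain ⟨C1, hC1, hp⟩ := poly_gauss_le P k hP
    set J := ∫ z, rho 0 a z with hJ
    have hJ0 : 0 ≤ J := integral_nonneg fun z => (rho_pos _ _ _).le
    refine ⟨Cg * C + C1 * (Cg * J), by positivity, fun α hα w hw y => ?_⟩
    have hα0 : 0 < α := ha.trans_le hα.1
    have hα2 : α < 2 := hα.2.trans_lt hb
    have hw0 := hw.1
    have c := hc α hα w hw y (Tf (G α)) Cg (hG.continuous hα0) (Tf_neg _) (hb1 α hα)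
    have p := hp α hα2 w hw y
    have hI : |∫ z, Tf (G α) z| ≤ Cg * J := by
      rw [hJ, ← integral_const_mul, ← Real.norm_eq_abs]
      refine norm_integral_le_of_norm_le ((rho_integrable 0 ha).const_mul _)
        (Eventually.of_forall fun z => (hb1 α hα z).trans ?_)
      exact mul_le_mul_of_nonneg_left (rho_anti 0 hα.1 z) hCg.le
    have e : fklm α k 0 0 y w =
        ∫ z, (P.eval (y - w * z) * gauss (y - w * z)) * Tf (G α) z := by
      unfold fklm
      rw [hGe α hα0, hPe]
    rw [e]
    set I := ∫ z, (P.eval (y - w * z) * gauss (y - w * z)) * Tf (G α) z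
    set S := ∫ z, Tf (G α) z
    have hL : 1 ≤ Real.log (1 / w) ^ k := one_le_pow₀ (one_le_log_inv hw)
    have hwa : 0 < w ^ α := by positivity
    have hr := rho_pos 0 α y
    have hg := gauss_pos y
    rw [pow_zero, mul_one] at c
    have t : |I| ≤ |I - P.eval y * gauss y * S| + |P.eval y * gauss y| * |S| := by
      rw [← abs_mul]
      have := abs_add_le (I - P.eval y * gauss y * S) (P.eval y * gauss y * S)
      rwa [sub_add_cancel] at this
    have c2 : Cg * C * w ^ α * rho 0 α y ≤
        Cg * C * Real.log (1 / w) ^ k * (gauss y + w ^ α * rho 0 α y) := by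
      calc Cg * C * w ^ α * rho 0 α y = Cg * C * 1 * (w ^ α * rho 0 α y) := by ring
        _ ≤ _ := by
          refine mul_le_mul (mul_le_mul_of_nonneg_left hL (by positivity)) (by linarith)
            (by positivity) (by positivity)
    have c3 : |P.eval y * gauss y| * |S| ≤
        (C1 * Real.log (1 / w) ^ k * (gauss y + w ^ α * rho 0 α y)) * (Cg * J) :=
      mul_le_mul p hI (abs_nonneg _) (by positivity)
    calc |I| ≤ _ := t
      _ ≤ Cg * C * Real.log (1 / w) ^ k * (gauss y + w ^ α * rho 0 α y) +
        (C1 * Real.log (1 / w) ^ k * (gauss y + w ^ α * rho 0 α y)) * (Cg * J) :=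
          add_le_add (c.trans c2) c3
      _ = _ := by ring
  · obtain ⟨G, hG, hGB, hGe⟩ := dop_family l m
    obtain ⟨Cg, hCg, hb1⟩ := hG.bound a b ha hb
    obtain ⟨C, hC, hc⟩ := conv_bound m P a b ha hb
    refine ⟨Cg * C, by positivity, fun α hα w hw y hlm => ?_⟩
    have hα0 : 0 < α := ha.trans_le hα.1
    have hα2 : α < 2 := hα.2.trans_lt hb
    have c := hc α hα w hw y (Tf (G α)) Cg (hG.continuous hα0) (Tf_neg _) (hb1 α hα)
    rw [(hGB hlm).integral_zero ⟨hα0, hα2⟩, mul_zero, sub_zero] at c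
    have e : fklm α k l m y w =
        ∫ z, (P.eval (y - w * z) * gauss (y - w * z)) * Tf (G α) z := by
      unfold fklm
      rw [hGe α hα0, hPe]
    rw [e]
    exact c

/-- uniform bounds for the functions `f_α^{(k,l,m)}`. -/
theorem statement14 (K : Set ℝ) (hK : IsCompact K) (hKsub : K ⊆ Set.Ioo (0 : ℝ) 2)
    (k l m : ℕ) (ψ : ℝ → ℕ → ℝ → ℝ) (hψ : IsPsiFamily ψ) :
    ∃ C > (0 : ℝ), ∀ α ∈ K, ∀ w ∈ Set.Ioc (0 : ℝ) (1 / 3), ∀ y : ℝ,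
      |fklm α k 0 0 y w| ≤ C * Real.log (1 / w) ^ k * (gauss y + w ^ α * ψ α 0 y) ∧
      (0 < l + m →
        |fklm α k l m y w| ≤ C * Real.log (1 / w) ^ m * w ^ α * ψ α m y) := by


  rcases K.eq_empty_or_nonempty with rfl | hne
  · exact ⟨1, one_pos, fun α hα => absurd hα (Set.notMem_empty α)⟩
  obtain ⟨a, haK, ha⟩ := hK.exists_isLeast hne
  obtain ⟨b, hbK, hb⟩ := hK.exists_isGreatest hne
  obtain ⟨⟨C1, hC1, h1⟩, ⟨C2, hC2, h2⟩⟩ := main_rho a b (hKsub haK).1 (hKsub hbK).2 k l m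
  obtain ⟨D1, hD1, g1⟩ := rho_le_psi 0 K hK hKsub ψ hψ
  obtain ⟨D2, hD2, g2⟩ := rho_le_psi m K hK hKsub ψ hψ
  refine ⟨C1 * (1 + D1) + C2 * D2, by positivity, fun α hα w hw y => ?_⟩
  have hI : α ∈ Icc a b := ⟨ha hα, hb hα⟩
  have hw0 := hw.1
  have hwa : 0 < w ^ α := by positivity
  have hL0 := one_le_log_inv hw
  have hg := gauss_pos y
  have hp0 := hψ.pos α (hKsub hα) 0 y
  have hpm := hψ.pos α (hKsub hα) m y
  constructor
  · refine (h1 α hI w hw y).trans ?_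
    have q1 : gauss y + w ^ α * rho 0 α y ≤ (1 + D1) * (gauss y + w ^ α * ψ α 0 y) := by
      have := mul_le_mul_of_nonneg_left (g1 α hα y) hwa.le
      have e1 : 0 < D1 * gauss y := by positivity
      have e2 : 0 < w ^ α * ψ α 0 y := by positivity
      linarith
    calc _ ≤ C1 * Real.log (1 / w) ^ k * ((1 + D1) * (gauss y + w ^ α * ψ α 0 y)) :=
          mul_le_mul_of_nonneg_left q1 (by positivity)
      _ = (C1 * (1 + D1)) * (Real.log (1 / w) ^ k * (gauss y + w ^ α * ψ α 0 y)) := by ring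
      _ ≤ (C1 * (1 + D1) + C2 * D2) * (Real.log (1 / w) ^ k * (gauss y + w ^ α * ψ α 0 y)) :=
          mul_le_mul_of_nonneg_right (by linarith [mul_pos hC2 hD2]) (by positivity)
      _ = _ := by ring
  · intro hlm
    refine (h2 α hI w hw y hlm).trans ?_
    calc _ ≤ C2 * Real.log (1 / w) ^ m * w ^ α * (D2 * ψ α m y) :=
          mul_le_mul_of_nonneg_left (g2 α hα y) (by positivity)
      _ = (C2 * D2) * (Real.log (1 / w) ^ m * w ^ α * ψ α m y) := by ring
      _ ≤ (C1 * (1 + D1) + C2 * D2) * (Real.log (1 / w) ^ m * w ^ α * ψ α m y) :=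
          mul_le_mul_of_nonneg_right (by linarith [mul_pos hC1 (by linarith : 0 < 1 + D1)])
            (by positivity)
      _ = _ := by ring

end LevyLAN
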